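/- arXiv:1806.09979 — 7 statements merged into one kernel-verified Lean document; each statement's English description precedes it below -/
import Mathlib

section
/- Let 0 < α < 1, let U ⊆ ℂ be a bounded open set, and let b ∈ ∂U. Then H^α_b(U) is dense in H^α(U): for every f ∈ H^α(U) and every ε > 0 there exists g ∈ H^α_b(U) such that ‖f − g‖_{H^α} < ε. -/
open Metric Set Filter

noncomputable section

/-- `f` is harmonic (twice continuously real-differentiable with vanishing Laplacian)
on the open set `U ⊆ ℂ`. -/
def HarmonicOnC (f : ℂ → ℂ) (U : Set ℂ) : Prop :=
  ContDiffOn ℝ 2 f U ∧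
    ∀ z ∈ U,
      fderiv ℝ (fun w => fderiv ℝ f w 1) z 1 +
        fderiv ℝ (fun w => fderiv ℝ f w Complex.I) z Complex.I = 0

/-- `f` satisfies a Lipschitz (Hölder) condition of order `α` on `E`. -/
def HolderOfOrderOn (α : ℝ) (E : Set ℂ) (f : ℂ → ℂ) : Prop :=
  ∃ C : ℝ, ∀ x ∈ E, ∀ y ∈ E, ‖f x - f y‖ ≤ C * ‖x - y‖ ^ α

/-- `f` belongs to the little Lipschitz class of order `α` on `E`:  it is Hölder of order
`α` and the Hölder quotients over pairs at distance `≤ δ` tend to `0` as `δ → 0⁺`. -/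
def LittleHolderOn (α : ℝ) (E : Set ℂ) (f : ℂ → ℂ) : Prop :=
  HolderOfOrderOn α E f ∧
    Tendsto
      (fun δ : ℝ =>
        sSup {q | ∃ x ∈ E, ∃ y ∈ E, x ≠ y ∧ ‖x - y‖ ≤ δ ∧ q = ‖f x - f y‖ / ‖x - y‖ ^ α})
      (nhdsWithin 0 (Set.Ioi 0)) (nhds 0)

/-- Membership in `H^α(U)`: harmonic on `U` and little-Lipschitz-`α` on `closure U`. -/
def MemHalpha (α : ℝ) (U : Set ℂ) (f : ℂ → ℂ) : Prop :=
  HarmonicOnC f U ∧ LittleHolderOn α (closure U) f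

/-- The `H^α` norm: sup of `|f|` over `closure U` plus the Hölder-`α` seminorm on
`closure U`. -/
def HNorm (α : ℝ) (U : Set ℂ) (f : ℂ → ℂ) : ℝ :=
  sSup ((fun x => ‖f x‖) '' closure U) +
    sSup {q | ∃ x ∈ closure U, ∃ y ∈ closure U, x ≠ y ∧ q = ‖f x - f y‖ / ‖x - y‖ ^ α}

/-- Membership in `H^α_b(U)`: a member of `H^α(U)` which agrees on `closure U` with some
function harmonic on `U ∪ B(b,r)` for some `r > 0`. -/
def MemHalphaB (α : ℝ) (U : Set ℂ) (b : ℂ) (f : ℂ → ℂ) : Prop :=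
  MemHalpha α U f ∧
    ∃ r : ℝ, 0 < r ∧ ∃ h : ℂ → ℂ,
      HarmonicOnC h (U ∪ Metric.ball b r) ∧ ∀ z ∈ closure U, h z = f z

open MeasureTheory Topology
open scoped Pointwise
open InnerProductSpace (HarmonicAt)

/-- Uniform bound for the integral of a Riesz kernel over a disc. -/
lemma exists_setIntegral_rpow_norm_sub_le {γ : ℝ} (hγ0 : 0 ≤ γ) (hγ : γ < 2) :
    ∃ C, 0 ≤ C ∧ ∀ (b x : ℂ) (R : ℝ), 0 < R →
      IntegrableOn (fun w => ‖x - w‖ ^ (-γ)) (ball b R) ∧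
        ∫ w in ball b R, ‖x - w‖ ^ (-γ) ≤ C * R ^ (2 - γ) := by
  have hmeas : Measurable (fun w : ℂ => ‖w‖ ^ (-γ)) := by fun_prop
  have hloc : ∀ R : ℝ, IntegrableOn (fun w : ℂ => ‖w‖ ^ (-γ)) (ball 0 R) := fun R =>
    integrableOn_ball_of_norm_le_rpow (C := 1) (α := γ) (by simp) (by simpa using hγ)
      (ae_of_all _ fun w => by
        rw [one_mul, Real.norm_of_nonneg (by positivity)]) hmeas.aestronglyMeasurable
  have hind : ∀ (x : ℂ) (R : ℝ), Integrable
      (fun w => (ball (0 : ℂ) R).indicator (fun w : ℂ => ‖w‖ ^ (-γ)) (x - w)) := fun x R =>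
    ((integrable_indicator_iff measurableSet_ball).2 (hloc R)).comp_sub_left x
  set J : ℝ := ∫ w in ball (0 : ℂ) 1, ‖w‖ ^ (-γ) with hJ
  have hJ0 : 0 ≤ J := integral_nonneg fun w => by positivity
  refine ⟨J + Real.pi, by positivity, fun b x R hR => ⟨?_, ?_⟩⟩
  · have h := (hind x (R + ‖x - b‖)).integrableOn (s := ball b R)
    refine h.congr_fun (fun w hw => ?_) measurableSet_ball
    refine indicator_of_mem ?_ _
    rw [mem_ball, dist_eq_norm] at hw
    rw [mem_ball_zero_iff]
    calc ‖x - w‖ = ‖(x - b) - (w - b)‖ := by ring_nf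
      _ ≤ ‖x - b‖ + ‖w - b‖ := norm_sub_le _ _
      _ < R + ‖x - b‖ := by linarith
  · have hscale : ∫ w in ball (0 : ℂ) R, ‖w‖ ^ (-γ) = R ^ (2 - γ) * J := by
      have h := Measure.setIntegral_comp_smul_of_pos (volume : Measure ℂ)
        (fun w : ℂ => ‖w‖ ^ (-γ)) (ball 0 1) hR
      have h2 : R • ball (0 : ℂ) 1 = ball 0 R := by
        rw [_root_.smul_ball hR.ne', smul_zero, Real.norm_of_nonneg hR.le, mul_one]
      rw [h2] at h
      have h3 : ∀ w : ℂ, ‖R • w‖ ^ (-γ) = R ^ (-γ) * ‖w‖ ^ (-γ) := fun w => by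
        rw [norm_smul, Real.norm_of_nonneg hR.le, Real.mul_rpow hR.le (norm_nonneg _)]
      simp only [h3, integral_const_mul, Complex.finrank_real_complex, smul_eq_mul] at h
      rw [sub_eq_add_neg, Real.rpow_add hR, mul_assoc, hJ, h]
      norm_cast
      field_simp
    have hle : ∀ w ∈ ball b R, ‖x - w‖ ^ (-γ) ≤
        (ball (0 : ℂ) R).indicator (fun w : ℂ => ‖w‖ ^ (-γ)) (x - w) + R ^ (-γ) := by
      intro w _
      by_cases h : x - w ∈ ball (0 : ℂ) R
      · rw [indicator_of_mem h]
        have : 0 ≤ R ^ (-γ) := by positivity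
        linarith
      · rw [indicator_of_notMem h, zero_add]
        rw [mem_ball_zero_iff, not_lt] at h
        exact Real.rpow_le_rpow_of_nonpos hR h (by linarith)
    have hvol : volume.real (ball b R) = R ^ 2 * Real.pi := by
      simp [measureReal_def, Complex.volume_ball, ENNReal.toReal_ofReal hR.le]
    have hfin : volume (ball b R) ≠ ⊤ := measure_ball_lt_top.ne
    calc ∫ w in ball b R, ‖x - w‖ ^ (-γ)
        ≤ ∫ w in ball b R, ((ball (0 : ℂ) R).indicator (fun w : ℂ => ‖w‖ ^ (-γ)) (x - w)
            + R ^ (-γ)) := by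
          refine integral_mono_of_nonneg (ae_of_all _ fun w => by positivity)
            ((hind x R).integrableOn.add (integrableOn_const hfin)) ?_
          exact (ae_restrict_iff' measurableSet_ball).2 (ae_of_all _ hle)
      _ = (∫ w in ball b R, (ball (0 : ℂ) R).indicator (fun w : ℂ => ‖w‖ ^ (-γ)) (x - w))
            + R ^ 2 * Real.pi * R ^ (-γ) := by
          rw [integral_add (hind x R).integrableOn (integrableOn_const hfin),
            setIntegral_const, hvol, smul_eq_mul]
      _ ≤ (∫ w, (ball (0 : ℂ) R).indicator (fun w : ℂ => ‖w‖ ^ (-γ)) (x - w))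
            + R ^ 2 * Real.pi * R ^ (-γ) := by
          refine add_le_add_left (setIntegral_le_integral (hind x R) (ae_of_all _ fun w => ?_)) _
          exact indicator_nonneg (fun w _ => by positivity) _
      _ = (J + Real.pi) * R ^ (2 - γ) := by
          rw [integral_sub_left_eq_self
            (fun w => (ball (0 : ℂ) R).indicator (fun w : ℂ => ‖w‖ ^ (-γ)) w) volume x,
            integral_indicator measurableSet_ball, hscale, sub_eq_add_neg (2 : ℝ),
            Real.rpow_add hR]
          norm_cast
          ring

/-- A measurable density bounded by `M` and vanishing outside the disc `ball b R`. -/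
structure IsDensity (ρ : ℂ → ℂ) (M : ℝ) (b : ℂ) (R : ℝ) : Prop where
  meas : AEStronglyMeasurable ρ volume
  bound : ∀ w, ‖ρ w‖ ≤ M
  supp : ∀ w, w ∉ ball b R → ρ w = 0

/-- The Cauchy transform of a density. -/
def cauchyT (ρ : ℂ → ℂ) (x : ℂ) : ℂ := ∫ w, ρ w * (x - w)⁻¹

/-- The logarithmic potential of a density. -/
def logT (ρ : ℂ → ℂ) (x : ℂ) : ℂ := ∫ w, ρ w * (Real.log ‖x - w‖ : ℂ)

lemma IsDensity.conj {ρ : ℂ → ℂ} {M : ℝ} {b : ℂ} {R : ℝ} (h : IsDensity ρ M b R) :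
    IsDensity (fun w => (starRingEnd ℂ) (ρ w)) M b R where
  meas := Complex.continuous_conj.comp_aestronglyMeasurable h.meas
  bound w := by simpa using h.bound w
  supp w hw := by simp [h.supp w hw]

lemma IsDensity.nonneg {ρ : ℂ → ℂ} {M : ℝ} {b : ℂ} {R : ℝ} (h : IsDensity ρ M b R) : 0 ≤ M :=
  (norm_nonneg _).trans (h.bound 0)

lemma IsDensity.norm_mul_le_indicator {ρ : ℂ → ℂ} {M : ℝ} {b : ℂ} {R : ℝ}
    (h : IsDensity ρ M b R) {k : ℂ} {t : ℝ} (w : ℂ) (hk : ‖k‖ ≤ t) :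
    ‖ρ w * k‖ ≤ (ball b R).indicator (fun _ => M * t) w := by
  by_cases hw : w ∈ ball b R
  · rw [indicator_of_mem hw, norm_mul]
    exact mul_le_mul (h.bound w) hk (norm_nonneg _) h.nonneg
  · rw [indicator_of_notMem hw, h.supp w hw]
    simp

lemma IsDensity.integrable_mul {ρ : ℂ → ℂ} {M : ℝ} {b : ℂ} {R : ℝ}
    (h : IsDensity ρ M b R) {k : ℂ → ℂ} (hk : AEStronglyMeasurable k volume) (x : ℂ) {B : ℝ}
    (hB : ∀ w ∈ ball b R, ‖k w‖ ≤ ‖x - w‖⁻¹ + B) : Integrable (fun w => ρ w * k w) := by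
  rcases le_or_gt R 0 with hR | hR
  · have : (fun w => ρ w * k w) = 0 := by
      ext w
      simp [h.supp w (by simp [ball_eq_empty.2 hR])]
    rw [this]
    exact integrable_zero _ _ _
  obtain ⟨C, -, hC⟩ := exists_setIntegral_rpow_norm_sub_le (γ := 1) (by norm_num) (by norm_num)
  have h1 : IntegrableOn (fun w => M * (‖x - w‖ ^ (-1 : ℝ) + B)) (ball b R) :=
    ((hC b x R hR).1.add (integrableOn_const measure_ball_lt_top.ne)).const_mul M
  have h2 := (integrable_indicator_iff measurableSet_ball).2 h1
  refine h2.mono' (h.meas.mul hk) (ae_of_all _ fun w => ?_)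
  by_cases hw : w ∈ ball b R
  · rw [indicator_of_mem hw, norm_mul, Real.rpow_neg_one]
    exact mul_le_mul (h.bound w) (hB w hw) (norm_nonneg _) h.nonneg
  · rw [indicator_of_notMem hw, h.supp w hw]
    simp

lemma IsDensity.integrable_cauchy {ρ : ℂ → ℂ} {M : ℝ} {b : ℂ} {R : ℝ}
    (h : IsDensity ρ M b R) (x : ℂ) : Integrable (fun w => ρ w * (x - w)⁻¹) :=
  h.integrable_mul (by fun_prop) x (B := 0) fun w _ => by simp

lemma Real.abs_log_le_inv_add {t : ℝ} (ht : 0 ≤ t) : |Real.log t| ≤ t⁻¹ + t := by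
  have h1 := Real.log_le_self ht
  have h2 := Real.log_le_self (inv_nonneg.2 ht)
  have h3 := inv_nonneg.2 ht
  rw [Real.log_inv] at h2
  rw [abs_le]
  constructor <;> linarith

lemma IsDensity.integrable_log {ρ : ℂ → ℂ} {M : ℝ} {b : ℂ} {R : ℝ}
    (h : IsDensity ρ M b R) (x : ℂ) : Integrable (fun w => ρ w * (Real.log ‖x - w‖ : ℂ)) := by
  refine h.integrable_mul (Measurable.aestronglyMeasurable (by fun_prop)) x
    (B := ‖x - b‖ + R) fun w hw => ?_
  rw [Complex.norm_real, Real.norm_eq_abs]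
  refine (Real.abs_log_le_inv_add (norm_nonneg _)).trans ?_
  have : ‖x - w‖ ≤ ‖x - b‖ + ‖b - w‖ := norm_sub_le_norm_sub_add_norm_sub _ _ _
  rw [mem_ball', dist_eq_norm] at hw
  linarith

lemma norm_inv_sub_inv_le {β : ℝ} (hβ0 : 0 < β) (hβ1 : β < 1) {z z' : ℂ} (hz : z ≠ 0)
    (hz' : z' ≠ 0) :
    ‖z⁻¹ - z'⁻¹‖ ≤ 2 * ‖z - z'‖ ^ β * (‖z‖ ^ (-(1 + β)) + ‖z'‖ ^ (-(1 + β))) := by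
  wlog hle : ‖z‖ ≤ ‖z'‖ generalizing z z'
  · rw [norm_sub_rev, norm_sub_rev z, add_comm (‖z‖ ^ _)]
    exact this hz' hz (le_of_not_ge hle)
  have ha : 0 < ‖z‖ := norm_pos_iff.2 hz
  have hb : 0 < ‖z'‖ := norm_pos_iff.2 hz'
  have hd : ‖z - z'‖ ≤ 2 * ‖z'‖ := (norm_sub_le _ _).trans (by linarith)
  rw [inv_sub_inv hz hz', norm_div, norm_mul, norm_sub_rev z' z]
  rcases (norm_nonneg (z - z')).eq_or_lt with h0 | h0
  · rw [← h0, zero_div]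
    positivity
  set a := ‖z‖
  set b := ‖z'‖
  set d := ‖z - z'‖
  have h1 : d ^ (1 - β) ≤ 2 * b ^ (1 - β) :=
    calc d ^ (1 - β) ≤ (2 * b) ^ (1 - β) := by gcongr
      _ = 2 ^ (1 - β) * b ^ (1 - β) := Real.mul_rpow (by norm_num) hb.le
      _ ≤ 2 * b ^ (1 - β) := by
        gcongr
        calc (2 : ℝ) ^ (1 - β) ≤ 2 ^ (1 : ℝ) :=
              Real.rpow_le_rpow_of_exponent_le (by norm_num) (by linarith)
          _ = 2 := Real.rpow_one 2
  have h2 : d = d ^ β * d ^ (1 - β) := by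
    rw [← Real.rpow_add h0]; simp
  have h3 : b ^ (1 - β) = b * b ^ (-β) := by
    rw [sub_eq_add_neg, Real.rpow_add hb, Real.rpow_one]
  have h4 : b ^ (-β) ≤ a ^ (-β) := Real.rpow_le_rpow_of_nonpos ha hle (by linarith)
  have h5 : a ^ (-(1 + β)) = a⁻¹ * a ^ (-β) := by
    rw [neg_add, Real.rpow_add ha, Real.rpow_neg_one]
  calc d / (a * b) = d ^ β * d ^ (1 - β) / (a * b) := by rw [← h2]
    _ ≤ d ^ β * (2 * b ^ (1 - β)) / (a * b) := by gcongr
    _ = 2 * d ^ β * (a⁻¹ * b ^ (-β)) := by rw [h3]; field_simp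
    _ ≤ 2 * d ^ β * (a⁻¹ * a ^ (-β)) := by gcongr
    _ ≤ 2 * d ^ β * (a ^ (-(1 + β)) + b ^ (-(1 + β))) := by
        rw [h5]
        gcongr
        have : 0 ≤ b ^ (-(1 + β)) := by positivity
        linarith

lemma abs_log_norm_sub_log_norm_le {β : ℝ} (hβ0 : 0 < β) (hβ1 : β < 1) {z z' : ℂ} (hz : z ≠ 0)
    (hz' : z' ≠ 0) :
    |Real.log ‖z‖ - Real.log ‖z'‖| ≤ β⁻¹ * ‖z - z'‖ ^ β * (‖z‖ ^ (-β) + ‖z'‖ ^ (-β)) := by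
  wlog hle : ‖z‖ ≤ ‖z'‖ generalizing z z'
  · rw [abs_sub_comm, norm_sub_rev z, add_comm (‖z‖ ^ _)]
    exact this hz' hz (le_of_not_ge hle)
  have ha : 0 < ‖z‖ := norm_pos_iff.2 hz
  have hb : 0 < ‖z'‖ := norm_pos_iff.2 hz'
  have hd : ‖z'‖ ≤ ‖z‖ + ‖z - z'‖ := by
    rw [norm_sub_rev z z']
    linarith [norm_sub_norm_le z' z]
  rw [abs_sub_comm, abs_of_nonneg (sub_nonneg.2 (Real.log_le_log ha hle))]
  set a := ‖z‖
  set b := ‖z'‖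
  set d := ‖z - z'‖
  have hd0 : 0 ≤ d := norm_nonneg _
  have h1 : b ^ β ≤ a ^ β + d ^ β :=
    (Real.rpow_le_rpow hb.le hd hβ0.le).trans (Real.rpow_add_le_add_rpow ha.le hd0 hβ0.le hβ1.le)
  have h2 : Real.log ((b / a) ^ β) ≤ (b / a) ^ β - 1 :=
    Real.log_le_sub_one_of_pos (by positivity)
  rw [Real.log_rpow (by positivity), Real.log_div hb.ne' ha.ne', Real.div_rpow hb.le ha.le] at h2
  have ha' : 0 < a ^ β := by positivity
  have h3 : b ^ β / a ^ β - 1 ≤ d ^ β * a ^ (-β) := by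
    rw [Real.rpow_neg ha.le, ← div_eq_mul_inv, div_sub_one ha'.ne']
    gcongr
    linarith
  calc Real.log b - Real.log a = β⁻¹ * (β * (Real.log b - Real.log a)) := by field_simp
    _ ≤ β⁻¹ * (d ^ β * a ^ (-β)) :=
      mul_le_mul_of_nonneg_left (h2.trans h3) (by positivity)
    _ ≤ β⁻¹ * d ^ β * (a ^ (-β) + b ^ (-β)) := by
      rw [mul_assoc]
      gcongr
      have : 0 ≤ b ^ (-β) := by positivity
      linarith

lemma IsDensity.norm_integral_mul_le {γ : ℝ} (hγ0 : 0 ≤ γ) (hγ : γ < 2) :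
    ∃ C, 0 ≤ C ∧ ∀ {ρ : ℂ → ℂ} {M : ℝ} {b : ℂ} {R : ℝ}, IsDensity ρ M b R → 0 < R →
      ∀ (k : ℂ → ℂ) (x y : ℂ) (t : ℝ), 0 ≤ t →
        (∀ w, w ≠ x → w ≠ y → ‖k w‖ ≤ t * (‖x - w‖ ^ (-γ) + ‖y - w‖ ^ (-γ))) →
        ‖∫ w, ρ w * k w‖ ≤ C * M * R ^ (2 - γ) * t := by
  obtain ⟨C, hC0, hC⟩ := exists_setIntegral_rpow_norm_sub_le hγ0 hγ
  refine ⟨2 * C, by positivity, fun {ρ M b R} h hR k x y t ht hk => ?_⟩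
  have hM := h.nonneg
  obtain ⟨hx, hx'⟩ := hC b x R hR
  obtain ⟨hy, hy'⟩ := hC b y R hR
  have hInt : IntegrableOn (fun w => M * (t * (‖x - w‖ ^ (-γ) + ‖y - w‖ ^ (-γ)))) (ball b R) :=
    ((hx.add hy).const_mul t).const_mul M
  have hae : ∀ᵐ w : ℂ, ‖ρ w * k w‖ ≤ (ball b R).indicator
      (fun w => M * (t * (‖x - w‖ ^ (-γ) + ‖y - w‖ ^ (-γ)))) w := by
    filter_upwards [compl_mem_ae_iff.2 (measure_singleton x),
      compl_mem_ae_iff.2 (measure_singleton y)] with w hwx hwy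
    exact h.norm_mul_le_indicator w (hk w hwx hwy)
  calc ‖∫ w, ρ w * k w‖
      ≤ ∫ w, (ball b R).indicator
          (fun w => M * (t * (‖x - w‖ ^ (-γ) + ‖y - w‖ ^ (-γ)))) w :=
        norm_integral_le_of_norm_le ((integrable_indicator_iff measurableSet_ball).2 hInt) hae
    _ = M * (t * ((∫ w in ball b R, ‖x - w‖ ^ (-γ)) + ∫ w in ball b R, ‖y - w‖ ^ (-γ))) := by
        rw [integral_indicator measurableSet_ball, integral_const_mul, integral_const_mul,
          integral_add hx hy]
    _ ≤ M * (t * (C * R ^ (2 - γ) + C * R ^ (2 - γ))) := by gcongr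
    _ = 2 * C * M * R ^ (2 - γ) * t := by ring

lemma exists_norm_cauchyT_sub_le {β : ℝ} (hβ0 : 0 < β) (hβ1 : β < 1) :
    ∃ C, 0 ≤ C ∧ ∀ {ρ : ℂ → ℂ} {M : ℝ} {b : ℂ} {R : ℝ}, IsDensity ρ M b R → 0 < R →
      ∀ x y, ‖cauchyT ρ x - cauchyT ρ y‖ ≤ C * M * R ^ (1 - β) * ‖x - y‖ ^ β := by
  obtain ⟨C, hC0, hC⟩ := IsDensity.norm_integral_mul_le (γ := 1 + β) (by linarith) (by linarith)
  refine ⟨2 * C, by positivity, fun {ρ M b R} h hR x y => ?_⟩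
  have h1 := hC h hR (fun w => (x - w)⁻¹ - (y - w)⁻¹) x y (2 * ‖x - y‖ ^ β) (by positivity)
    fun w hwx hwy => by
      have := norm_inv_sub_inv_le hβ0 hβ1 (sub_ne_zero.2 hwx.symm) (sub_ne_zero.2 hwy.symm)
      rwa [sub_sub_sub_cancel_right] at this
  simp only [mul_sub] at h1
  rw [integral_sub (h.integrable_cauchy x) (h.integrable_cauchy y)] at h1
  refine h1.trans (le_of_eq ?_)
  rw [show 2 - (1 + β) = 1 - β by ring]
  ring

lemma exists_norm_logT_sub_le {β : ℝ} (hβ0 : 0 < β) (hβ1 : β < 1) :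
    ∃ C, 0 ≤ C ∧ ∀ {ρ : ℂ → ℂ} {M : ℝ} {b : ℂ} {R : ℝ}, IsDensity ρ M b R → 0 < R →
      ∀ x y, ‖logT ρ x - logT ρ y‖ ≤ C * M * R ^ (2 - β) * ‖x - y‖ ^ β := by
  obtain ⟨C, hC0, hC⟩ := IsDensity.norm_integral_mul_le (γ := β) (by linarith) (by linarith)
  refine ⟨C * β⁻¹, by positivity, fun {ρ M b R} h hR x y => ?_⟩
  have h1 := hC h hR (fun w => (Real.log ‖x - w‖ : ℂ) - (Real.log ‖y - w‖ : ℂ)) x y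
    (β⁻¹ * ‖x - y‖ ^ β) (by positivity) fun w hwx hwy => by
      have := abs_log_norm_sub_log_norm_le hβ0 hβ1 (sub_ne_zero.2 hwx.symm)
        (sub_ne_zero.2 hwy.symm)
      rwa [sub_sub_sub_cancel_right, ← Real.norm_eq_abs, ← Complex.norm_real,
        Complex.ofReal_sub] at this
  simp only [mul_sub] at h1
  rw [integral_sub (h.integrable_log x) (h.integrable_log y)] at h1
  refine h1.trans (le_of_eq ?_)
  ring

lemma half_le_norm_sub {z₀ x w : ℂ} {s : ℝ} (hx : x ∈ ball z₀ (s / 2)) (hw : w ∉ ball z₀ s) :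
    s / 2 ≤ ‖x - w‖ := by
  rw [mem_ball, dist_eq_norm] at hx hw
  have : ‖w - z₀‖ ≤ ‖w - x‖ + ‖x - z₀‖ := norm_sub_le_norm_sub_add_norm_sub _ _ _
  rw [norm_sub_rev]
  linarith

lemma IsDensity.differentiableOn_integral {ρ : ℂ → ℂ} {M : ℝ} {b : ℂ} {R : ℝ}
    (h : IsDensity ρ M b R) {z₀ : ℂ} {s : ℝ} (hz : ∀ w ∈ ball z₀ s, ρ w = 0)
    {K K' : ℂ → ℂ → ℂ} {B : ℝ}
    (hKm : ∀ x, AEStronglyMeasurable (K x) volume)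
    (hKm' : ∀ x, AEStronglyMeasurable (K' x) volume)
    (hB : ∀ x ∈ ball z₀ (s / 2), ∀ w ∉ ball z₀ s, ‖K x w‖ ≤ B)
    (hB' : ∀ x ∈ ball z₀ (s / 2), ∀ w ∉ ball z₀ s, ‖K' x w‖ ≤ B)
    (hd : ∀ x ∈ ball z₀ (s / 2), ∀ w ∉ ball z₀ s, HasDerivAt (K · w) (K' x w) x) :
    DifferentiableOn ℂ (fun x => ∫ w, ρ w * K x w) (ball z₀ (s / 2)) := by
  intro x hx
  have hInt : Integrable ((ball b R).indicator (fun _ => M * B)) :=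
    (integrable_indicator_iff measurableSet_ball).2
      (integrableOn_const measure_ball_lt_top.ne)
  have key : ∀ (k : ℂ → ℂ), (∀ w ∉ ball z₀ s, ‖k w‖ ≤ B) →
      ∀ w, ‖ρ w * k w‖ ≤ (ball b R).indicator (fun _ => M * B) w := by
    intro k hk w
    by_cases hw : w ∈ ball z₀ s
    · have hB0 : 0 ≤ M * B ∨ w ∉ ball b R := by
        by_cases hwb : w ∈ ball b R
        · left
          by_contra hneg
          have hBneg : B < 0 := by
            by_contra hB0
            exact hneg (mul_nonneg h.nonneg (not_lt.1 hB0))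
          have hall : ∀ v, v ∈ ball z₀ s := fun v => by
            by_contra hv
            exact absurd ((norm_nonneg _).trans (hk v hv)) (not_le.2 hBneg)
          have := hall (z₀ + s)
          rw [mem_ball, dist_eq_norm, add_sub_cancel_left, Complex.norm_real] at this
          exact absurd this (not_lt.2 (le_abs_self s))
        · exact Or.inr hwb
      rw [hz w hw, zero_mul, norm_zero]
      rcases hB0 with h0 | h0
      · exact indicator_nonneg (fun _ _ => h0) w
      · rw [indicator_of_notMem h0]
    · exact h.norm_mul_le_indicator w (hk w hw)
  refine (hasDerivAt_integral_of_dominated_loc_of_deriv_le (isOpen_ball.mem_nhds hx)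
    (F' := fun x w => ρ w * K' x w) (bound := (ball b R).indicator (fun _ => M * B))
    (Eventually.of_forall fun x => h.meas.mul (hKm x))
    (hInt.mono' (h.meas.mul (hKm x)) (ae_of_all _ (key _ (hB x hx))))
    (h.meas.mul (hKm' x)) (ae_of_all _ fun w y hy => key _ (hB' y hy) w) hInt
    (ae_of_all _ fun w y hy => ?_)).2.differentiableAt.differentiableWithinAt
  by_cases hw : w ∈ ball z₀ s
  · simpa [hz w hw] using hasDerivAt_const y (0 : ℂ)
  · exact (hd y hy w hw).const_mul (ρ w)

lemma IsDensity.harmonicAt_cauchyT {ρ : ℂ → ℂ} {M : ℝ} {b : ℂ} {R : ℝ}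
    (h : IsDensity ρ M b R) {z₀ : ℂ} {s : ℝ} (hs : 0 < s) (hz : ∀ w ∈ ball z₀ s, ρ w = 0) :
    HarmonicAt (cauchyT ρ) z₀ := by
  have hne : ∀ x ∈ ball z₀ (s / 2), ∀ w ∉ ball z₀ s, x - w ≠ 0 := fun x hx w hw h0 => by
    have := half_le_norm_sub hx hw
    rw [h0, norm_zero] at this
    linarith
  have hinv : ∀ x ∈ ball z₀ (s / 2), ∀ w ∉ ball z₀ s, ‖(x - w)⁻¹‖ ≤ 2 / s := fun x hx w hw => by
    rw [norm_inv, ← inv_div]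
    exact inv_anti₀ (by positivity) (half_le_norm_sub hx hw)
  have hd := h.differentiableOn_integral hz (K := fun x w => (x - w)⁻¹)
    (K' := fun x w => -1 / (x - w) ^ 2) (B := 2 / s + (2 / s) ^ 2)
    (fun x => by fun_prop) (fun x => Measurable.aestronglyMeasurable (by fun_prop))
    (fun x hx w hw => (hinv x hx w hw).trans (le_add_of_nonneg_right (by positivity)))
    (fun x hx w hw => by
      rw [neg_div, norm_neg, one_div, ← inv_pow, norm_pow]
      refine le_add_of_nonneg_of_le (by positivity) ?_
      gcongr
      exact hinv x hx w hw)
    (fun x hx w hw => ((hasDerivAt_id x).sub_const w).inv (hne x hx w hw))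
  exact (hd.analyticAt (ball_mem_nhds z₀ (by positivity))).harmonicAt

lemma HarmonicAt.conj {f : ℂ → ℂ} {z : ℂ} (h : HarmonicAt f z) :
    HarmonicAt (fun x => (starRingEnd ℂ) (f x)) z :=
  h.comp_CLM (Complex.conjCLE : ℂ →L[ℝ] ℂ)

lemma IsDensity.harmonicAt_logT {ρ : ℂ → ℂ} {M : ℝ} {b : ℂ} {R : ℝ}
    (h : IsDensity ρ M b R) {z₀ : ℂ} {s : ℝ} (hs : 0 < s) (hz : ∀ w ∈ ball z₀ s, ρ w = 0) :
    HarmonicAt (logT ρ) z₀ := by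
  let K : ℂ → ℂ → ℂ := fun x w => Complex.log (1 + (x - z₀) / (z₀ - w))
  have hne : ∀ x ∈ ball z₀ (s / 2), ∀ w ∉ ball z₀ s, x - w ≠ 0 := fun x hx w hw h0 => by
    have := half_le_norm_sub hx hw
    rw [h0, norm_zero] at this
    linarith
  have hz₀ : z₀ ∈ ball z₀ (s / 2) := mem_ball_self (by positivity)
  have hu : ∀ x ∈ ball z₀ (s / 2), ∀ w ∉ ball z₀ s, ‖(x - z₀) / (z₀ - w)‖ ≤ 1 / 2 := by
    intro x hx w hw
    have h1 : s ≤ ‖z₀ - w‖ := by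
      rw [mem_ball', dist_eq_norm] at hw
      exact not_lt.1 hw
    rw [mem_ball, dist_eq_norm] at hx
    rw [norm_div, div_le_iff₀ (hs.trans_le h1)]
    linarith
  have hKm : ∀ x, AEStronglyMeasurable (K x) volume := fun x =>
    Measurable.aestronglyMeasurable (by fun_prop)
  have hB : ∀ x ∈ ball z₀ (s / 2), ∀ w ∉ ball z₀ s, ‖K x w‖ ≤ 1 + 2 / s := fun x hx w hw => by
    have := Complex.norm_log_one_add_half_le_self (hu x hx w hw)
    have h2 : 0 ≤ 2 / s := by positivity
    have := hu x hx w hw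
    simp only [K]
    linarith
  have hd : ∀ {ρ : ℂ → ℂ}, IsDensity ρ M b R → (∀ w ∈ ball z₀ s, ρ w = 0) →
      HarmonicAt (fun x => ∫ w, ρ w * K x w) z₀ := by
    intro ρ h hz
    have hd := h.differentiableOn_integral hz (K := K)
      (K' := fun x w => (x - w)⁻¹) (B := 1 + 2 / s) hKm (fun x => by fun_prop) hB
      (fun x hx w hw => by
        rw [norm_inv]
        refine le_add_of_nonneg_of_le (by positivity) ?_
        rw [← inv_div]
        exact inv_anti₀ (by positivity) (half_le_norm_sub hx hw))
      (fun x hx w hw => by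
        have h1 : HasDerivAt (fun x => 1 + (x - z₀) / (z₀ - w)) (1 / (z₀ - w)) x :=
          (((hasDerivAt_id x).sub_const z₀).div_const (z₀ - w)).const_add 1
        have h2 := h1.clog (Complex.mem_slitPlane_of_norm_lt_one
          ((hu x hx w hw).trans_lt (by norm_num)))
        have h3 := hne x hx w hw
        have h4 := hne z₀ hz₀ w hw
        convert h2 using 1
        have h5 : 1 + (x - z₀) / (z₀ - w) = (x - w) / (z₀ - w) := by field_simp; ring
        rw [h5]
        field_simp)
    exact (hd.analyticAt (ball_mem_nhds z₀ (by positivity))).harmonicAt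
  have hInt : ∀ {ρ : ℂ → ℂ}, IsDensity ρ M b R → (∀ w ∈ ball z₀ s, ρ w = 0) →
      ∀ x ∈ ball z₀ (s / 2), Integrable fun w => ρ w * K x w := by
    intro ρ h hz x hx
    have hB0 : 0 ≤ M * (1 + 2 / s) := mul_nonneg h.nonneg (by positivity)
    have hInt : Integrable ((ball b R).indicator (fun _ => M * (1 + 2 / s))) :=
      (integrable_indicator_iff measurableSet_ball).2
        (integrableOn_const measure_ball_lt_top.ne)
    refine hInt.mono' (h.meas.mul (hKm x)) (ae_of_all _ fun w => ?_)
    by_cases hw : w ∈ ball z₀ s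
    · rw [hz w hw, zero_mul, norm_zero]
      exact indicator_nonneg (fun _ _ => hB0) w
    · exact h.norm_mul_le_indicator w (hB x hx w hw)
  have hzc : ∀ w ∈ ball z₀ s, (starRingEnd ℂ) (ρ w) = 0 := fun w hw => by simp [hz w hw]
  have hform : ∀ x ∈ ball z₀ (s / 2), logT ρ x = logT ρ z₀ +
      (2⁻¹ : ℝ) • ((∫ w, ρ w * K x w) +
        (starRingEnd ℂ) (∫ w, (starRingEnd ℂ) (ρ w) * K x w)) := by
    intro x hx
    have hpt : ∀ w, ρ w * (Real.log ‖x - w‖ : ℂ) = ρ w * (Real.log ‖z₀ - w‖ : ℂ) +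
        (2⁻¹ : ℝ) • (ρ w * K x w + (starRingEnd ℂ) ((starRingEnd ℂ) (ρ w) * K x w)) := by
      intro w
      by_cases hw : w ∈ ball z₀ s
      · simp [hz w hw]
      have h3 := hne x hx w hw
      have h4 := hne z₀ hz₀ w hw
      have h5 : 1 + (x - z₀) / (z₀ - w) = (x - w) / (z₀ - w) := by field_simp; ring
      have h6 : (Real.log ‖x - w‖ : ℂ) = (Real.log ‖z₀ - w‖ : ℂ) + ((K x w).re : ℂ) := by
        simp only [K]
        rw [Complex.log_re, h5, norm_div,
          Real.log_div (norm_ne_zero_iff.2 h3) (norm_ne_zero_iff.2 h4)]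
        push_cast
        ring
      rw [h6, Complex.re_eq_add_conj, map_mul, Complex.conj_conj, Complex.real_smul]
      push_cast
      ring
    have hc : Integrable fun w => (starRingEnd ℂ) ((starRingEnd ℂ) (ρ w) * K x w) :=
      (Complex.conjCLE : ℂ →L[ℝ] ℂ).integrable_comp (hInt h.conj hzc x hx)
    have hsum : Integrable fun w => (2⁻¹ : ℝ) •
        (ρ w * K x w + (starRingEnd ℂ) ((starRingEnd ℂ) (ρ w) * K x w)) :=
      ((hInt h hz x hx).add hc).smul (2⁻¹ : ℝ)
    simp only [logT]
    simp_rw [hpt]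
    rw [integral_add (h.integrable_log z₀) hsum,
      integral_smul, integral_add (hInt h hz x hx) hc, integral_conj]
  have hev : logT ρ =ᶠ[𝓝 z₀] (fun _ => logT ρ z₀) + (2⁻¹ : ℝ) •
      ((fun x => ∫ w, ρ w * K x w) +
        fun x => (starRingEnd ℂ) (∫ w, (starRingEnd ℂ) (ρ w) * K x w)) := by
    filter_upwards [ball_mem_nhds z₀ (half_pos hs)] with x hx
    simpa using hform x hx
  rw [InnerProductSpace.harmonicAt_congr_nhds hev]
  exact (InnerProductSpace.harmonicAt_const _).add
    (((hd h hz).add (HarmonicAt.conj (hd h.conj hzc))).const_smul)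

lemma ContDiffAt.laplacian_complexPlane_eq {f : ℂ → ℂ} {z : ℂ} (h : ContDiffAt ℝ 2 f z) :
    Laplacian.laplacian f z = fderiv ℝ (fun w => fderiv ℝ f w 1) z 1 +
      fderiv ℝ (fun w => fderiv ℝ f w Complex.I) z Complex.I := by
  have h2 : DifferentiableAt ℝ (fderiv ℝ f) z :=
    (h.fderiv_right (m := 1) (by norm_num)).differentiableAt (by norm_num)
  have h3 : ∀ v u : ℂ, fderiv ℝ (fun w => fderiv ℝ f w v) z u = fderiv ℝ (fderiv ℝ f) z u v := by
    intro v u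
    rw [fderiv_clm_apply h2 (by fun_prop)]
    simp
  rw [InnerProductSpace.laplacian_eq_iteratedFDeriv_complexPlane, h3, h3]
  simp [iteratedFDeriv_two_apply]

lemma harmonicOnC_of_harmonicAt {f : ℂ → ℂ} {U : Set ℂ} (h : ∀ z ∈ U, HarmonicAt f z) :
    HarmonicOnC f U :=
  ⟨fun z hz => (h z hz).1.contDiffWithinAt, fun z hz => by
    rw [← (h z hz).1.laplacian_complexPlane_eq]
    exact (h z hz).2.eq_of_nhds⟩

lemma HarmonicOnC.harmonicAt {f : ℂ → ℂ} {U : Set ℂ} (h : HarmonicOnC f U) (hU : IsOpen U)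
    {z : ℂ} (hz : z ∈ U) : HarmonicAt f z := by
  refine ⟨h.1.contDiffAt (hU.mem_nhds hz), ?_⟩
  filter_upwards [hU.mem_nhds hz] with w hw
  rw [(h.1.contDiffAt (hU.mem_nhds hw)).laplacian_complexPlane_eq]
  exact h.2 w hw

/-- The derivative of `f` in the direction `e`. -/
def dirD (e : ℂ) (f : ℂ → ℂ) (w : ℂ) : ℂ := fderiv ℝ f w e

/-- The Laplacian. -/
def lap (f : ℂ → ℂ) (w : ℂ) : ℂ := dirD 1 (dirD 1 f) w + dirD Complex.I (dirD Complex.I f) w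

/-- The derivative in direction `e` of the logarithmic potential of `ρ`. -/
def dirT (e : ℂ) (ρ : ℂ → ℂ) (x : ℂ) : ℂ := ∫ w, ρ w * ((e * (x - w)⁻¹).re : ℂ)

lemma Continuous.exists_isDensity {q : ℂ → ℂ} (hq : Continuous q) (hc : HasCompactSupport q) :
    ∃ M R, 0 < R ∧ IsDensity q M 0 R := by
  obtain ⟨M, hM⟩ := hc.exists_bound_of_continuous hq
  obtain ⟨R, hR0, hR⟩ := hc.isCompact.isBounded.exists_pos_norm_lt
  refine ⟨M, R, hR0, hq.aestronglyMeasurable, hM, fun w hw => ?_⟩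
  by_contra h
  exact hw (mem_ball_zero_iff.2 (hR w (subset_tsupport q h)))

lemma IsDensity.integrable_dir {ρ : ℂ → ℂ} {M : ℝ} {b : ℂ} {R : ℝ} (h : IsDensity ρ M b R)
    {e : ℂ} (he : ‖e‖ = 1) (x : ℂ) : Integrable fun w => ρ w * ((e * (x - w)⁻¹).re : ℂ) := by
  refine h.integrable_mul (Measurable.aestronglyMeasurable (by fun_prop)) x
    (B := 0) fun w _ => ?_
  rw [Complex.norm_real, add_zero]
  refine (Complex.abs_re_le_norm _).trans ?_
  rw [norm_mul, he, one_mul, norm_inv]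

lemma integral_eq_zero_of_hasDerivAt_re {Ψ D : ℂ → ℂ} {x : ℂ} (hΨ : Integrable Ψ)
    (hD : Integrable D)
    (h : ∀ w, w ≠ x → HasDerivAt (fun t : ℝ => Ψ (w + t * 1)) (D w) 0) : ∫ w, D w = 0 := by
  have mp := Complex.volume_preserving_equiv_real_prod.symm
  have emb := Complex.measurableEquivRealProd.symm.measurableEmbedding
  have hΨ' : Integrable (fun p : ℝ × ℝ => Ψ (Complex.measurableEquivRealProd.symm p))
      (volume.prod volume) := mp.integrable_comp_of_integrable hΨ
  have hD' : Integrable (fun p : ℝ × ℝ => D (Complex.measurableEquivRealProd.symm p))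
      (volume.prod volume) := mp.integrable_comp_of_integrable hD
  rw [← mp.integral_comp emb, Measure.volume_eq_prod, integral_prod_symm _ hD']
  refine integral_eq_zero_of_ae ?_
  filter_upwards [hΨ'.prod_left_ae, hD'.prod_left_ae,
    compl_mem_ae_iff.2 (measure_singleton x.im)] with y h1 h2 hy
  refine integral_eq_zero_of_hasDerivAt_of_integrable (f := fun s =>
    Ψ (Complex.measurableEquivRealProd.symm (s, y))) (fun s => ?_) h2 h1
  have h3 := h (Complex.measurableEquivRealProd.symm (s, y)) (fun h0 => hy (by
    rw [← h0]; rfl))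
  have h4 : (fun s => Ψ (Complex.measurableEquivRealProd.symm (s, y))) = fun u : ℝ =>
      (fun t : ℝ => Ψ (Complex.measurableEquivRealProd.symm (s, y) + t * 1)) (u - s) := by
    ext u
    congr 1
    apply Complex.ext <;> simp [Complex.measurableEquivRealProd]
  rw [h4]
  rw [← sub_self s] at h3
  exact h3.comp_sub_const s s

lemma integral_eq_zero_of_hasDerivAt_im {Ψ D : ℂ → ℂ} {x : ℂ} (hΨ : Integrable Ψ)
    (hD : Integrable D)
    (h : ∀ w, w ≠ x → HasDerivAt (fun t : ℝ => Ψ (w + t * Complex.I)) (D w) 0) :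
    ∫ w, D w = 0 := by
  have mp := Complex.volume_preserving_equiv_real_prod.symm
  have emb := Complex.measurableEquivRealProd.symm.measurableEmbedding
  have hΨ' : Integrable (fun p : ℝ × ℝ => Ψ (Complex.measurableEquivRealProd.symm p))
      (volume.prod volume) := mp.integrable_comp_of_integrable hΨ
  have hD' : Integrable (fun p : ℝ × ℝ => D (Complex.measurableEquivRealProd.symm p))
      (volume.prod volume) := mp.integrable_comp_of_integrable hD
  rw [← mp.integral_comp emb, Measure.volume_eq_prod, integral_prod _ hD']
  refine integral_eq_zero_of_ae ?_
  filter_upwards [hΨ'.prod_right_ae, hD'.prod_right_ae,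
    compl_mem_ae_iff.2 (measure_singleton x.re)] with y h1 h2 hy
  refine integral_eq_zero_of_hasDerivAt_of_integrable (f := fun s =>
    Ψ (Complex.measurableEquivRealProd.symm (y, s))) (fun s => ?_) h2 h1
  have h3 := h (Complex.measurableEquivRealProd.symm (y, s)) (fun h0 => hy (by
    rw [← h0]; rfl))
  have h4 : (fun s => Ψ (Complex.measurableEquivRealProd.symm (y, s))) = fun u : ℝ =>
      (fun t : ℝ => Ψ (Complex.measurableEquivRealProd.symm (y, s) + t * Complex.I)) (u - s) := by
    ext u
    congr 1
    apply Complex.ext <;> simp [Complex.measurableEquivRealProd]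
  rw [h4]
  rw [← sub_self s] at h3
  exact h3.comp_sub_const s s

lemma hasDerivAt_log_norm_sub {x w : ℂ} (e : ℂ) (hw : w ≠ x) :
    HasDerivAt (fun t : ℝ => Real.log ‖x - (w + t * e)‖) (-(e * (x - w)⁻¹).re) 0 := by
  have hz : x - w ≠ 0 := sub_ne_zero.2 hw.symm
  have hn : Complex.normSq (x - w) ≠ 0 := by simpa using hz
  have h1 : ∀ t : ℝ, Real.log ‖x - (w + t * e)‖ =
      Real.log (((x - w).re - t * e.re) ^ 2 + ((x - w).im - t * e.im) ^ 2) / 2 := by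
    intro t
    have : ((x - w).re - t * e.re) ^ 2 + ((x - w).im - t * e.im) ^ 2 = ‖x - (w + t * e)‖ ^ 2 := by
      rw [← Complex.normSq_eq_norm_sq, Complex.normSq_apply]
      simp
      ring
    rw [this, Real.log_pow]
    push_cast
    ring
  simp_rw [h1]
  have h2 : HasDerivAt (fun t : ℝ => ((x - w).re - t * e.re) ^ 2 + ((x - w).im - t * e.im) ^ 2)
      (2 * (x - w).re * -e.re + 2 * (x - w).im * -e.im) 0 := by
    have ha : HasDerivAt (fun t : ℝ => (x - w).re - t * e.re) (-e.re) 0 := by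
      simpa using ((hasDerivAt_id (0 : ℝ)).mul_const e.re).const_sub (x - w).re
    have hb : HasDerivAt (fun t : ℝ => (x - w).im - t * e.im) (-e.im) 0 := by
      simpa using ((hasDerivAt_id (0 : ℝ)).mul_const e.im).const_sub (x - w).im
    simpa using (ha.fun_pow 2).fun_add (hb.fun_pow 2)
  have h3 : ((x - w).re - 0 * e.re) ^ 2 + ((x - w).im - 0 * e.im) ^ 2 =
      Complex.normSq (x - w) := by
    rw [Complex.normSq_apply]; ring
  have h4 := (h2.log (by rw [h3]; exact hn)).div_const 2
  rw [h3] at h4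
  refine h4.congr_deriv ?_
  rw [Complex.mul_re, Complex.inv_re, Complex.inv_im]
  field_simp
  ring

lemma hasDerivAt_dirD {q : ℂ → ℂ} (hq : Differentiable ℝ q) (w e : ℂ) :
    HasDerivAt (fun t : ℝ => q (w + t * e)) (dirD e q w) 0 := by
  have h := (hq w).hasFDerivAt.hasLineDerivAt e
  simpa [HasLineDerivAt, dirD] using h

lemma continuous_dirD {q : ℂ → ℂ} (hq : ContDiff ℝ 1 q) (e : ℂ) : Continuous (dirD e q) :=
  (hq.continuous_fderiv (by norm_num)).clm_apply continuous_const

lemma ContDiff.dirD {q : ℂ → ℂ} {n m : WithTop ℕ∞} (hq : ContDiff ℝ n q) (h : m + 1 ≤ n) (e : ℂ) :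
    ContDiff ℝ m (dirD e q) :=
  (hq.fderiv_right h).clm_apply contDiff_const

lemma HasCompactSupport.dirD {q : ℂ → ℂ} (hq : HasCompactSupport q) (e : ℂ) :
    HasCompactSupport (dirD e q) :=
  hq.fderiv_apply ℝ e

lemma logT_dirD {q : ℂ → ℂ} (hq : ContDiff ℝ 1 q) (hc : HasCompactSupport q) {e : ℂ}
    (he : e = 1 ∨ e = Complex.I) (x : ℂ) : logT (dirD e q) x = dirT e q x := by
  have he1 : ‖e‖ = 1 := by rcases he with rfl | rfl <;> simp
  obtain ⟨M, R, hR, hd⟩ := hq.continuous.exists_isDensity hc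
  obtain ⟨M', R', hR', hd'⟩ := (continuous_dirD hq e).exists_isDensity (hc.dirD e)
  have hder : ∀ w, w ≠ x → HasDerivAt
      (fun t : ℝ => q (w + t * e) * (Real.log ‖x - (w + t * e)‖ : ℂ))
      (dirD e q w * (Real.log ‖x - w‖ : ℂ) - q w * ((e * (x - w)⁻¹).re : ℂ)) 0 := by
    intro w hw
    have := (hasDerivAt_dirD (hq.differentiable (by norm_num)) w e).fun_mul
      (hasDerivAt_log_norm_sub e hw).ofReal_comp
    refine this.congr_deriv ?_
    simp only [Complex.ofReal_zero, zero_mul, add_zero, Complex.ofReal_neg]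
    ring
  have key : ∫ w, (dirD e q w * (Real.log ‖x - w‖ : ℂ) - q w * ((e * (x - w)⁻¹).re : ℂ)) = 0 := by
    rcases he with rfl | rfl
    · exact integral_eq_zero_of_hasDerivAt_re (hd.integrable_log x)
        ((hd'.integrable_log x).sub (hd.integrable_dir he1 x)) hder
    · exact integral_eq_zero_of_hasDerivAt_im (hd.integrable_log x)
        ((hd'.integrable_log x).sub (hd.integrable_dir he1 x)) hder
  rw [integral_sub (hd'.integrable_log x) (hd.integrable_dir he1 x)] at key
  exact sub_eq_zero.1 key

lemma integral_fderiv_radial {ψ : ℂ → ℂ} (hψ : ContDiff ℝ 1 ψ) (hc : HasCompactSupport ψ) (x : ℂ) :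
    ∫ v, (‖v‖ ^ 2)⁻¹ • fderiv ℝ ψ (x + v) v = -(2 * Real.pi * ψ x) := by
  rw [← Complex.integral_comp_polarCoord_symm]
  let c : ℝ → ℂ := fun θ => Real.cos θ + Real.sin θ * Complex.I
  have hcn : ∀ θ, ‖c θ‖ = 1 := fun θ => by
    simp only [c, Complex.ofReal_cos, Complex.ofReal_sin, ← Complex.exp_mul_I]
    exact Complex.norm_exp_ofReal_mul_I θ
  have hcc : Continuous c := by fun_prop
  have hfc := hψ.continuous_fderiv (by norm_num)
  let F : ℝ × ℝ → ℂ := fun p => fderiv ℝ ψ (x + p.1 * c p.2) (c p.2)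
  have hF : Continuous F := (hfc.comp (by fun_prop)).clm_apply (hcc.comp continuous_snd)
  have h1 : ∫ p in polarCoord.target, p.1 • ((‖Complex.polarCoord.symm p‖ ^ 2)⁻¹ •
      fderiv ℝ ψ (x + Complex.polarCoord.symm p) (Complex.polarCoord.symm p)) =
      ∫ p in Ioi (0 : ℝ) ×ˢ Ioo (-Real.pi) Real.pi, F p := by
    refine setIntegral_congr_fun (by exact measurableSet_Ioi.prod measurableSet_Ioo)
      fun p hp => ?_
    have hp1 : 0 < p.1 := hp.1
    have h2 : Complex.polarCoord.symm p = p.1 • c p.2 := by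
      rw [Complex.polarCoord_symm_apply, Complex.real_smul]
    simp only [F]
    rw [h2, norm_smul, hcn, mul_one, Real.norm_of_nonneg hp1.le, map_smul, smul_smul, smul_smul,
      Complex.real_smul, Complex.real_smul]
    have : p.1 * (p.1 ^ 2)⁻¹ * p.1 = 1 := by field_simp
    rw [this]
    simp
  rw [h1]
  obtain ⟨R, hR0, hR⟩ := (hc.fderiv ℝ).isCompact.isBounded.exists_pos_norm_lt
  have hInt : IntegrableOn F (Ioi (0 : ℝ) ×ˢ Ioo (-Real.pi) Real.pi) := by
    have hk : IntegrableOn F (Icc 0 (R + ‖x‖) ×ˢ Icc (-Real.pi) Real.pi) :=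
      hF.continuousOn.integrableOn_compact (isCompact_Icc.prod isCompact_Icc)
    refine hk.of_forall_sdiff_eq_zero (measurableSet_Ioi.prod measurableSet_Ioo) fun p hp => ?_
    have hp1 : 0 < p.1 := hp.1.1
    have hp2 : R + ‖x‖ < p.1 := by
      by_contra h
      exact hp.2 ⟨⟨hp1.le, not_lt.1 h⟩, Ioo_subset_Icc_self hp.1.2⟩
    have h0 : fderiv ℝ ψ (x + p.1 * c p.2) = 0 := by
      by_contra h
      have h3 := hR _ (subset_tsupport _ h)
      have h4 : ‖(p.1 : ℂ) * c p.2‖ ≤ ‖x + p.1 * c p.2‖ + ‖x‖ := by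
        have := norm_sub_le (x + p.1 * c p.2) x
        rwa [add_sub_cancel_left] at this
      rw [norm_mul, hcn, mul_one, Complex.norm_real, Real.norm_of_nonneg hp1.le] at h4
      linarith
    simp [F, h0]
  rw [IntegrableOn, Measure.volume_eq_prod, ← Measure.prod_restrict] at hInt
  rw [Measure.volume_eq_prod, ← Measure.prod_restrict, integral_prod_symm _ hInt]
  have hinner : ∀ θ, ∫ r in Ioi (0 : ℝ), F (r, θ) = -ψ x := by
    intro θ
    let f : ℝ → ℂ := fun r => ψ (x + r * c θ)
    have hf : ContDiff ℝ 1 f := hψ.comp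
      (contDiff_const.add (Complex.ofRealCLM.contDiff.mul contDiff_const))
    have hfs : HasCompactSupport f := by
      obtain ⟨R, hR0, hR⟩ := hc.isCompact.isBounded.exists_pos_norm_lt
      refine HasCompactSupport.of_support_subset_isCompact
        (isCompact_closedBall (0 : ℝ) (R + ‖x‖)) fun r hr => ?_
      have h3 := hR _ (subset_tsupport _ hr)
      have h4 : ‖(r : ℂ) * c θ‖ ≤ ‖x + r * c θ‖ + ‖x‖ := by
        have := norm_sub_le (x + r * c θ) x
        rwa [add_sub_cancel_left] at this
      rw [norm_mul, hcn, mul_one, Complex.norm_real] at h4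
      rw [mem_closedBall_zero_iff]
      linarith
    have hder : ∀ r, deriv f r = F (r, θ) := by
      intro r
      have h5 : HasDerivAt (fun r : ℝ => x + r * c θ) (c θ) r := by
        simpa using ((hasDerivAt_id r).ofReal_comp.mul_const (c θ)).const_add x
      exact (((hψ.differentiable (by norm_num)) _).hasFDerivAt.comp_hasDerivAt r h5).deriv
    have := hfs.integral_Ioi_deriv_eq hf 0
    simp only [hder] at this
    rw [this]
    simp [f]
  simp only [hinner]
  rw [setIntegral_const, Real.volume_real_Ioo_of_le (by linarith [Real.pi_pos]),
    Complex.real_smul]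
  push_cast
  ring

lemma dirT_dirD_add {ψ : ℂ → ℂ} (hψ : ContDiff ℝ 1 ψ) (hc : HasCompactSupport ψ) (x : ℂ) :
    dirT 1 (dirD 1 ψ) x + dirT Complex.I (dirD Complex.I ψ) x = 2 * Real.pi * ψ x := by
  obtain ⟨M, R, hR, hd⟩ := (continuous_dirD hψ 1).exists_isDensity (hc.dirD 1)
  obtain ⟨M', R', hR', hd'⟩ :=
    (continuous_dirD hψ Complex.I).exists_isDensity (hc.dirD Complex.I)
  have h1 := integral_fderiv_radial hψ hc x
  rw [← neg_eq_iff_eq_neg, ← integral_neg] at h1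
  rw [← h1, dirT, dirT, ← integral_add (hd.integrable_dir (by simp) x)
    (hd'.integrable_dir (by simp) x),
    ← integral_sub_right_eq_self (fun v => -((‖v‖ ^ 2)⁻¹ • fderiv ℝ ψ (x + v) v)) x]
  congr 1
  ext w
  have h2 : (w - x) = (w - x).re • (1 : ℂ) + (w - x).im • Complex.I := by
    apply Complex.ext <;> simp
  have h3 : fderiv ℝ ψ w (w - x) = (w - x).re * fderiv ℝ ψ w 1 +
      (w - x).im * fderiv ℝ ψ w Complex.I := by
    conv_lhs => rw [h2]
    rw [map_add, map_smul, map_smul, Complex.real_smul, Complex.real_smul]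
  have h4 : ((1 * (x - w)⁻¹).re : ℂ) = -((‖w - x‖ ^ 2)⁻¹ * (w - x).re : ℝ) := by
    rw [← Complex.ofReal_neg, one_mul, Complex.inv_re, norm_sub_rev, ← Complex.normSq_eq_norm_sq]
    congr 1
    simp
    ring
  have h5 : ((Complex.I * (x - w)⁻¹).re : ℂ) = -((‖w - x‖ ^ 2)⁻¹ * (w - x).im : ℝ) := by
    rw [← Complex.ofReal_neg, Complex.I_mul_re, Complex.inv_im, norm_sub_rev,
      ← Complex.normSq_eq_norm_sq]
    congr 1
    simp
    ring
  rw [h4, h5, add_sub_cancel, h3, Complex.real_smul]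
  simp only [dirD]
  push_cast
  ring

lemma IsDensity.dirT_eq {ρ : ℂ → ℂ} {M : ℝ} {b : ℂ} {R : ℝ} (h : IsDensity ρ M b R) (e : ℂ) :
    dirT e ρ = fun x => (2⁻¹ : ℂ) * (e * cauchyT ρ x +
      (starRingEnd ℂ) (e * cauchyT (fun w => (starRingEnd ℂ) (ρ w)) x)) := by
  ext x
  rw [cauchyT, cauchyT, ← integral_const_mul, ← integral_const_mul, ← integral_conj,
    ← integral_add, ← integral_const_mul, dirT]
  · congr 1
    ext w
    rw [Complex.re_eq_add_conj]
    simp only [map_mul, Complex.conj_conj]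
    ring
  · exact (h.integrable_cauchy x).const_mul e
  · exact Complex.conjCLE.toContinuousLinearMap.integrable_comp
      ((h.conj.integrable_cauchy x).const_mul e)

lemma HarmonicAt.const_mul {f : ℂ → ℂ} {z : ℂ} (h : HarmonicAt f z) (c : ℂ) :
    HarmonicAt (fun x => c * f x) z :=
  h.comp_CLM ((ContinuousLinearMap.mul ℝ ℂ) c)

lemma IsDensity.harmonicAt_dirT {ρ : ℂ → ℂ} {M : ℝ} {b : ℂ} {R : ℝ}
    (h : IsDensity ρ M b R) (e : ℂ) {z₀ : ℂ} {s : ℝ} (hs : 0 < s)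
    (hz : ∀ w ∈ ball z₀ s, ρ w = 0) : HarmonicAt (dirT e ρ) z₀ := by
  rw [h.dirT_eq]
  refine HarmonicAt.const_mul (HarmonicAt.add ?_ (HarmonicAt.conj ?_)) _
  · exact HarmonicAt.const_mul (h.harmonicAt_cauchyT hs hz) e
  · exact HarmonicAt.const_mul (h.conj.harmonicAt_cauchyT hs fun w hw => by simp [hz w hw]) e

lemma exists_norm_dirT_sub_le {β : ℝ} (hβ0 : 0 < β) (hβ1 : β < 1) :
    ∃ C, 0 ≤ C ∧ ∀ {e : ℂ}, ‖e‖ = 1 → ∀ {ρ : ℂ → ℂ} {M : ℝ} {b : ℂ} {R : ℝ},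
      IsDensity ρ M b R → 0 < R →
      ∀ x y, ‖dirT e ρ x - dirT e ρ y‖ ≤ C * M * R ^ (1 - β) * ‖x - y‖ ^ β := by
  obtain ⟨C, hC0, hC⟩ := exists_norm_cauchyT_sub_le hβ0 hβ1
  refine ⟨C, hC0, fun {e} he {ρ M b R} h hR x y => ?_⟩
  have h1 := hC h hR x y
  have h2 := hC h.conj hR x y
  have h3 : dirT e ρ x - dirT e ρ y = (2⁻¹ : ℂ) * (e * (cauchyT ρ x - cauchyT ρ y) +
      (starRingEnd ℂ) (e * (cauchyT (fun w => (starRingEnd ℂ) (ρ w)) x -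
        cauchyT (fun w => (starRingEnd ℂ) (ρ w)) y))) := by
    rw [h.dirT_eq]
    simp only [map_mul, map_sub]
    ring
  rw [h3, norm_mul]
  have h4 := norm_add_le (e * (cauchyT ρ x - cauchyT ρ y))
    ((starRingEnd ℂ) (e * (cauchyT (fun w => (starRingEnd ℂ) (ρ w)) x -
        cauchyT (fun w => (starRingEnd ℂ) (ρ w)) y)))
  rw [RCLike.norm_conj, norm_mul, norm_mul, he] at h4
  have h5 : ‖(2⁻¹ : ℂ)‖ = 2⁻¹ := by simp
  rw [h5]
  linarith

lemma isDensity_mul {H q : ℂ → ℂ} {b : ℂ} {R M K : ℝ} (hH : AEStronglyMeasurable H volume)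
    (hq : Continuous q) (hM : 0 ≤ M) (hHb : ∀ w ∈ ball b R, ‖H w‖ ≤ M) (hqb : ∀ w, ‖q w‖ ≤ K)
    (hqs : ∀ w ∉ ball b R, q w = 0) : IsDensity (fun w => H w * q w) (M * K) b R where
  meas := hH.mul hq.aestronglyMeasurable
  bound w := by
    by_cases hw : w ∈ ball b R
    · rw [norm_mul]
      exact mul_le_mul (hHb w hw) (hqb w) (norm_nonneg _) hM
    · rw [hqs w hw, mul_zero, norm_zero]
      exact mul_nonneg hM ((norm_nonneg _).trans (hqb w))
  supp w hw := by simp [hqs w hw]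

/-- The potential which localises the singularities of `H` by the cutoff `Φ`. -/
def locT (Φ H : ℂ → ℂ) (x : ℂ) : ℂ :=
  2 * dirT 1 (fun w => H w * dirD 1 Φ w) x +
    2 * dirT Complex.I (fun w => H w * dirD Complex.I Φ w) x - logT (fun w => H w * lap Φ w) x

lemma continuous_lap {q : ℂ → ℂ} (hq : ContDiff ℝ 2 q) : Continuous (lap q) :=
  (continuous_dirD (hq.dirD (by norm_num) 1) 1).add
    (continuous_dirD (hq.dirD (by norm_num) Complex.I) Complex.I)

lemma HasCompactSupport.lap {q : ℂ → ℂ} (hq : HasCompactSupport q) : HasCompactSupport (lap q) :=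
  ((hq.dirD 1).dirD 1).add ((hq.dirD Complex.I).dirD Complex.I)

lemma dirD_eq_zero {q : ℂ → ℂ} {w : ℂ} (h : w ∉ tsupport q) (e : ℂ) : dirD e q w = 0 := by
  have := image_eq_zero_of_notMem_tsupport fun h1 => h (tsupport_fderiv_subset ℝ h1)
  simp [dirD, this]

lemma tsupport_dirD_subset (q : ℂ → ℂ) (e : ℂ) : tsupport (dirD e q) ⊆ tsupport q :=
  tsupport_fderiv_apply_subset ℝ e

lemma lap_eq_zero {q : ℂ → ℂ} {w : ℂ} (h : w ∉ tsupport q) : lap q w = 0 := by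
  rw [lap, dirD_eq_zero fun h1 => h (tsupport_dirD_subset q _ h1),
    dirD_eq_zero fun h1 => h (tsupport_dirD_subset q _ h1), add_zero]

lemma dirD_congr {p q : ℂ → ℂ} {w : ℂ} (h : p =ᶠ[𝓝 w] q) (e : ℂ) : dirD e p =ᶠ[𝓝 w] dirD e q :=
  (h.fderiv (𝕜 := ℝ)).mono fun _ h1 => by simp only [dirD, h1]

lemma lap_congr {p q : ℂ → ℂ} {w : ℂ} (h : p =ᶠ[𝓝 w] q) : lap p =ᶠ[𝓝 w] lap q :=
  (dirD_congr (dirD_congr h 1) 1).add (dirD_congr (dirD_congr h Complex.I) Complex.I)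

section
variable {Φ H : ℂ → ℂ} {b : ℂ} {R M K : ℝ}

lemma isDensity_mul_dirD (hΦ : ContDiff ℝ 2 Φ) (hs : tsupport Φ ⊆ ball b R)
    (hH : AEStronglyMeasurable H volume) (hM : 0 ≤ M) (hHb : ∀ w ∈ ball b R, ‖H w‖ ≤ M) (e : ℂ)
    (hK : ∀ w, ‖dirD e Φ w‖ ≤ K) : IsDensity (fun w => H w * dirD e Φ w) (M * K) b R :=
  isDensity_mul hH (continuous_dirD (hΦ.of_le (by norm_num)) e) hM hHb hK
    fun _ hw => dirD_eq_zero (fun h => hw (hs h)) e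

lemma isDensity_mul_lap (hΦ : ContDiff ℝ 2 Φ) (hs : tsupport Φ ⊆ ball b R)
    (hH : AEStronglyMeasurable H volume) (hM : 0 ≤ M) (hHb : ∀ w ∈ ball b R, ‖H w‖ ≤ M)
    (hK : ∀ w, ‖lap Φ w‖ ≤ K) : IsDensity (fun w => H w * lap Φ w) (M * K) b R :=
  isDensity_mul hH (continuous_lap hΦ) hM hHb hK
    fun _ hw => lap_eq_zero (fun h => hw (hs h))

lemma exists_forall_norm_dirD_le (hΦ : ContDiff ℝ 2 Φ) (hc : HasCompactSupport Φ) :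
    ∃ K, ∀ w, ‖dirD 1 Φ w‖ ≤ K ∧ ‖dirD Complex.I Φ w‖ ≤ K ∧ ‖lap Φ w‖ ≤ K := by
  obtain ⟨K1, h1⟩ := (hc.dirD 1).exists_bound_of_continuous
    (continuous_dirD (hΦ.of_le (by norm_num)) 1)
  obtain ⟨K2, h2⟩ := (hc.dirD Complex.I).exists_bound_of_continuous
    (continuous_dirD (hΦ.of_le (by norm_num)) Complex.I)
  obtain ⟨K3, h3⟩ := hc.lap.exists_bound_of_continuous (continuous_lap hΦ)
  exact ⟨max K1 (max K2 K3), fun w => ⟨(h1 w).trans (le_max_left _ _),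
    (h2 w).trans ((le_max_left _ _).trans (le_max_right _ _)),
    (h3 w).trans ((le_max_right _ _).trans (le_max_right _ _))⟩⟩

lemma harmonicAt_locT (hΦ : ContDiff ℝ 2 Φ) (hs : tsupport Φ ⊆ ball b R)
    (hH : AEStronglyMeasurable H volume) (hHb : ∀ w, ‖H w‖ ≤ M)
    {z₀ : ℂ} {s : ℝ} (hs0 : 0 < s)
    (hz : ∀ w ∈ ball z₀ s, H w = 0 ∨ dirD 1 Φ w = 0 ∧ dirD Complex.I Φ w = 0 ∧ lap Φ w = 0) :
    HarmonicAt (locT Φ H) z₀ := by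
  have hM : 0 ≤ M := (norm_nonneg _).trans (hHb 0)
  have hc : HasCompactSupport Φ :=
    (isCompact_closedBall b R).of_isClosed_subset (isClosed_tsupport _)
      (hs.trans ball_subset_closedBall)
  obtain ⟨K, hK⟩ := exists_forall_norm_dirD_le hΦ hc
  refine HarmonicAt.sub (HarmonicAt.add (HarmonicAt.const_mul ?_ _)
    (HarmonicAt.const_mul ?_ _)) ?_
  · refine (isDensity_mul_dirD hΦ hs hH hM (fun w _ => hHb w) 1
      fun w => (hK w).1).harmonicAt_dirT 1 hs0 fun w hw => ?_
    rcases hz w hw with h | h <;> simp [h]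
  · refine (isDensity_mul_dirD hΦ hs hH hM (fun w _ => hHb w) Complex.I
      fun w => (hK w).2.1).harmonicAt_dirT Complex.I hs0 fun w hw => ?_
    rcases hz w hw with h | h <;> simp [h]
  · refine (isDensity_mul_lap hΦ hs hH hM (fun w _ => hHb w)
      fun w => (hK w).2.2).harmonicAt_logT hs0 fun w hw => ?_
    rcases hz w hw with h | h <;> simp [h]

lemma IsDensity.dirT_add {ρ σ : ℂ → ℂ} {M M' R R' : ℝ} {b b' : ℂ} (h : IsDensity ρ M b R)
    (h' : IsDensity σ M' b' R') {e : ℂ} (he : ‖e‖ = 1) (x : ℂ) :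
    dirT e (fun w => ρ w + σ w) x = dirT e ρ x + dirT e σ x := by
  simp only [dirT, add_mul]
  exact integral_add (h.integrable_dir he x) (h'.integrable_dir he x)

lemma IsDensity.logT_add {ρ σ : ℂ → ℂ} {M M' R R' : ℝ} {b b' : ℂ} (h : IsDensity ρ M b R)
    (h' : IsDensity σ M' b' R') (x : ℂ) :
    logT (fun w => ρ w + σ w) x = logT ρ x + logT σ x := by
  simp only [logT, add_mul]
  exact integral_add (h.integrable_log x) (h'.integrable_log x)

lemma locT_add (hΦ : ContDiff ℝ 2 Φ) (hs : tsupport Φ ⊆ ball b R) {G : ℂ → ℂ} {M' : ℝ}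
    (hH : AEStronglyMeasurable H volume) (hHb : ∀ w, ‖H w‖ ≤ M)
    (hG : AEStronglyMeasurable G volume) (hGb : ∀ w, ‖G w‖ ≤ M') (x : ℂ) :
    locT Φ (fun w => H w + G w) x = locT Φ H x + locT Φ G x := by
  have hM : 0 ≤ M := (norm_nonneg _).trans (hHb 0)
  have hM' : 0 ≤ M' := (norm_nonneg _).trans (hGb 0)
  have hc : HasCompactSupport Φ :=
    (isCompact_closedBall b R).of_isClosed_subset (isClosed_tsupport _)
      (hs.trans ball_subset_closedBall)
  obtain ⟨K, hK⟩ := exists_forall_norm_dirD_le hΦ hc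
  have h1 := (isDensity_mul_dirD hΦ hs hH hM (fun w _ => hHb w) 1 fun w => (hK w).1).dirT_add
    (isDensity_mul_dirD hΦ hs hG hM' (fun w _ => hGb w) 1 fun w => (hK w).1) (e := 1) (by simp) x
  have h2 := (isDensity_mul_dirD hΦ hs hH hM (fun w _ => hHb w) Complex.I
    fun w => (hK w).2.1).dirT_add (isDensity_mul_dirD hΦ hs hG hM' (fun w _ => hGb w) Complex.I
      fun w => (hK w).2.1) (e := Complex.I) (by simp) x
  have h3 := (isDensity_mul_lap hΦ hs hH hM (fun w _ => hHb w) fun w => (hK w).2.2).logT_add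
    (isDensity_mul_lap hΦ hs hG hM' (fun w _ => hGb w) fun w => (hK w).2.2) x
  simp only [locT, add_mul, h1, h2, h3]
  ring

end

lemma Continuous.exists_isDensity_mul {p q : ℂ → ℂ} (hp : Continuous p) (hq : Continuous q)
    (hc : HasCompactSupport p ∨ HasCompactSupport q) :
    ∃ M R, IsDensity (fun w => p w * q w) M 0 R := by
  obtain ⟨M, R, _, h⟩ := (hp.mul hq).exists_isDensity
    (hc.elim (fun h => h.mul_right) fun h => h.mul_left)
  exact ⟨M, R, h⟩

lemma dirD_mul {p q : ℂ → ℂ} (hp : Differentiable ℝ p) (hq : Differentiable ℝ q) (e w : ℂ) :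
    dirD e (fun w => p w * q w) w = p w * dirD e q w + q w * dirD e p w := by
  simp [dirD, fderiv_fun_mul (hp w) (hq w)]

lemma dirD_sub {p q : ℂ → ℂ} (hp : Differentiable ℝ p) (hq : Differentiable ℝ q) (e w : ℂ) :
    dirD e (fun w => p w - q w) w = dirD e p w - dirD e q w := by
  simp [dirD, fderiv_fun_sub (hp w) (hq w)]

lemma logT_mul_dirD_sub {Φ G : ℂ → ℂ} (hΦ : ContDiff ℝ 2 Φ) (hc : HasCompactSupport Φ)
    (hG : ContDiff ℝ 2 G) {e : ℂ} (he : e = 1 ∨ e = Complex.I) (x : ℂ) :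
    logT (fun w => Φ w * dirD e (dirD e G) w) x - logT (fun w => G w * dirD e (dirD e Φ) w) x =
      dirT e (fun w => Φ w * dirD e G w) x - dirT e (fun w => G w * dirD e Φ w) x := by
  have he1 : ‖e‖ = 1 := by rcases he with rfl | rfl <;> simp
  have dΦ := hΦ.differentiable (by norm_num)
  have dG := hG.differentiable (by norm_num)
  have cΦ : ContDiff ℝ 1 (dirD e Φ) := hΦ.dirD (by norm_num) e
  have cG : ContDiff ℝ 1 (dirD e G) := hG.dirD (by norm_num) e
  have ddΦ := cΦ.differentiable (by norm_num)
  have ddG := cG.differentiable (by norm_num)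
  have hq := logT_dirD (q := fun w => Φ w * dirD e G w - G w * dirD e Φ w)
    (((hΦ.of_le (by norm_num)).mul cG).sub ((hG.of_le (by norm_num)).mul cΦ))
    (hc.mul_right.sub (hc.dirD e).mul_left) he x
  have h1 : dirD e (fun w => Φ w * dirD e G w - G w * dirD e Φ w) =
      fun w => Φ w * dirD e (dirD e G) w - G w * dirD e (dirD e Φ) w := by
    ext w
    rw [dirD_sub (dΦ.fun_mul ddG) (dG.fun_mul ddΦ), dirD_mul dΦ ddG, dirD_mul dG ddΦ]
    ring
  rw [h1] at hq
  obtain ⟨_, _, d1⟩ := hΦ.continuous.exists_isDensity_mul (continuous_dirD cG e) (.inl hc)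
  obtain ⟨_, _, d2⟩ := hG.continuous.exists_isDensity_mul (continuous_dirD cΦ e)
    (.inr ((hc.dirD e).dirD e))
  obtain ⟨_, _, d3⟩ := hΦ.continuous.exists_isDensity_mul cG.continuous (.inl hc)
  obtain ⟨_, _, d4⟩ := hG.continuous.exists_isDensity_mul cΦ.continuous
    (.inr (hc.dirD e))
  simp only [logT, dirT] at hq ⊢
  rw [← integral_sub (d1.integrable_log x) (d2.integrable_log x),
    ← integral_sub (d3.integrable_dir he1 x) (d4.integrable_dir he1 x)]
  simpa only [sub_mul] using hq

lemma locT_add_logT {Φ G : ℂ → ℂ} (hΦ : ContDiff ℝ 2 Φ) (hc : HasCompactSupport Φ)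
    (hG : ContDiff ℝ 2 G) (x : ℂ) :
    locT Φ G x + logT (fun w => Φ w * lap G w) x = 2 * Real.pi * (Φ x * G x) := by
  have dΦ := hΦ.differentiable (by norm_num)
  have dG := hG.differentiable (by norm_num)
  have cΦ : ∀ e, ContDiff ℝ 1 (dirD e Φ) := hΦ.dirD (by norm_num)
  have cG : ∀ e, ContDiff ℝ 1 (dirD e G) := hG.dirD (by norm_num)
  have h1 := dirT_dirD_add (ψ := fun w => Φ w * G w)
    ((hΦ.mul hG).of_le (by norm_num)) hc.mul_right x
  have hT : ∀ e : ℂ, ‖e‖ = 1 → dirT e (dirD e (fun w => Φ w * G w)) x =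
      dirT e (fun w => Φ w * dirD e G w) x + dirT e (fun w => G w * dirD e Φ w) x := by
    intro e he
    obtain ⟨_, _, d3⟩ := hΦ.continuous.exists_isDensity_mul (cG e).continuous (.inl hc)
    obtain ⟨_, _, d4⟩ := hG.continuous.exists_isDensity_mul (cΦ e).continuous
      (.inr (hc.dirD e))
    rw [← d3.dirT_add d4 he]
    congr 1
    ext w
    exact dirD_mul dΦ dG e w
  have hL : ∀ e : ℂ, ∃ M R M' R', IsDensity (fun w => Φ w * dirD e (dirD e G) w) M 0 R ∧
      IsDensity (fun w => G w * dirD e (dirD e Φ) w) M' 0 R' := by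
    intro e
    obtain ⟨M, R, d1⟩ :=
      hΦ.continuous.exists_isDensity_mul (continuous_dirD (cG e) e) (.inl hc)
    obtain ⟨M', R', d2⟩ := hG.continuous.exists_isDensity_mul (continuous_dirD (cΦ e) e)
      (.inr ((hc.dirD e).dirD e))
    exact ⟨M, R, M', R', d1, d2⟩
  obtain ⟨_, _, _, _, a1, a2⟩ := hL 1
  obtain ⟨_, _, _, _, b1, b2⟩ := hL Complex.I
  have h2 := logT_mul_dirD_sub hΦ hc hG (.inl rfl) x
  have h3 := logT_mul_dirD_sub hΦ hc hG (.inr rfl) x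
  rw [hT 1 (by simp), hT Complex.I (by simp)] at h1
  have h4 := a1.logT_add b1 x
  have h5 := a2.logT_add b2 x
  simp only [locT, lap, mul_add, h4, h5]
  linear_combination h1 + h2 + h3

lemma Real.rpow_le_rpow_sub_mul_rpow {t D α β : ℝ} (ht : 0 ≤ t) (htD : t ≤ D) (hα : 0 ≤ α)
    (hαβ : α ≤ β) : t ^ β ≤ D ^ (β - α) * t ^ α := by
  have h := sub_nonneg.2 hαβ
  calc t ^ β = t ^ (β - α) * t ^ α := by rw [← Real.rpow_add_of_nonneg ht h hα, sub_add_cancel]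
    _ ≤ D ^ (β - α) * t ^ α := by gcongr

lemma littleHolderOn_iff {α : ℝ} {E : Set ℂ} {f : ℂ → ℂ} (hα : 0 < α) :
    LittleHolderOn α E f ↔ HolderOfOrderOn α E f ∧ ∀ η > 0, ∃ δ > 0, ∀ x ∈ E, ∀ y ∈ E,
      ‖x - y‖ ≤ δ → ‖f x - f y‖ ≤ η * ‖x - y‖ ^ α := by
  have hpos : ∀ {x y : ℂ}, x ≠ y → 0 < ‖x - y‖ ^ α := fun h =>
    Real.rpow_pos_of_pos (norm_pos_iff.2 (sub_ne_zero.2 h)) _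
  refine and_congr_right fun ⟨C, hC⟩ => ⟨fun h η hη => ?_, fun h => ?_⟩
  · obtain ⟨δ, h1, hδ⟩ := ((h.eventually_lt_const hη).and self_mem_nhdsWithin).exists
    refine ⟨δ, hδ, fun x hx y hy hxy => ?_⟩
    rcases eq_or_ne x y with rfl | hne
    · simp [Real.zero_rpow hα.ne']
    · rw [← div_le_iff₀ (hpos hne)]
      refine le_trans (le_csSup ?_ ?_) h1.le
      · refine ⟨C, ?_⟩
        rintro q ⟨x, hx, y, hy, hne, -, rfl⟩
        exact (div_le_iff₀ (hpos hne)).2 (hC x hx y hy)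
      · exact ⟨x, hx, y, hy, hne, hxy, rfl⟩
  · rw [Metric.tendsto_nhds]
    intro η hη
    obtain ⟨δ, hδ, h1⟩ := h (η / 2) (half_pos hη)
    filter_upwards [Ioc_mem_nhdsGT hδ] with t ht
    rw [Real.dist_eq, sub_zero, abs_of_nonneg]
    · refine lt_of_le_of_lt (Real.sSup_le ?_ (half_pos hη).le) (half_lt_self hη)
      rintro q ⟨x, hx, y, hy, hne, hxy, rfl⟩
      exact (div_le_iff₀ (hpos hne)).2 (h1 x hx y hy (hxy.trans ht.2))
    · refine Real.sSup_nonneg ?_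
      rintro q ⟨x, hx, y, hy, hne, hxy, rfl⟩
      positivity

lemma HNorm_le {α : ℝ} {U : Set ℂ} {v : ℂ → ℂ} {A B : ℝ} (hA : 0 ≤ A) (hB : 0 ≤ B)
    (h1 : ∀ x ∈ closure U, ‖v x‖ ≤ A)
    (h2 : ∀ x ∈ closure U, ∀ y ∈ closure U, ‖v x - v y‖ ≤ B * ‖x - y‖ ^ α) :
    HNorm α U v ≤ A + B := by
  refine add_le_add (Real.sSup_le ?_ hA) (Real.sSup_le ?_ hB)
  · rintro _ ⟨x, hx, rfl⟩
    exact h1 x hx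
  · rintro _ ⟨x, hx, y, hy, hne, rfl⟩
    exact (div_le_iff₀ (Real.rpow_pos_of_pos (norm_pos_iff.2 (sub_ne_zero.2 hne)) _)).2
      (h2 x hx y hy)

lemma dirD_comp_smul_sub {q : ℂ → ℂ} (hq : Differentiable ℝ q) (e b : ℂ) (t : ℝ) (w : ℂ) :
    dirD e (fun w => q (t • (w - b))) w = t * dirD e q (t • (w - b)) := by
  have h1 : HasFDerivAt (fun w : ℂ => t • (w - b)) (t • ContinuousLinearMap.id ℝ ℂ) w :=
    ((hasFDerivAt_id w).sub_const b).const_smul t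
  have h2 := (hq (t • (w - b))).hasFDerivAt.comp w h1
  rw [dirD, HasFDerivAt.fderiv (f := fun w => q (t • (w - b))) h2]
  simp [dirD]

lemma lap_comp_smul_sub {q : ℂ → ℂ} (hq : ContDiff ℝ 2 q) (b : ℂ) (t : ℝ) (w : ℂ) :
    lap (fun w => q (t • (w - b))) w = t ^ 2 * lap q (t • (w - b)) := by
  have h : ∀ e, dirD e (dirD e fun w => q (t • (w - b))) w =
      t ^ 2 * dirD e (dirD e q) (t • (w - b)) := by
    intro e
    have h1 : (dirD e fun w => q (t • (w - b))) = fun w => (t : ℂ) * dirD e q (t • (w - b)) :=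
      funext fun w => dirD_comp_smul_sub (hq.differentiable (by norm_num)) e b t w
    have h2 : Differentiable ℝ fun w => dirD e q (t • (w - b)) :=
      ((hq.dirD (by norm_num) e).differentiable (n := 1) (by norm_num)).comp
        ((differentiable_id.sub_const b).const_smul t)
    rw [h1, dirD_mul (differentiable_const _) h2, dirD_comp_smul_sub
      ((hq.dirD (by norm_num) e).differentiable (n := 1) (by norm_num))]
    simp [dirD]
    ring
  simp only [lap, h]
  ring

/-- `φ` is a smooth cutoff equal to `1` on `ball b r` and supported in `ball b (2 * r)`, with
derivatives of the natural size. -/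
structure IsCutoff (K : ℝ) (b : ℂ) (r : ℝ) (φ : ℂ → ℂ) : Prop where
  contDiff : ContDiff ℝ 2 φ
  tsupport_subset : tsupport φ ⊆ ball b (2 * r)
  eq_one : ∀ w ∈ ball b r, φ w = 1
  norm_le_one : ∀ w, ‖φ w‖ ≤ 1
  norm_map_sub_le : ∀ x y, ‖φ x - φ y‖ ≤ K / r * ‖x - y‖
  norm_dirD_le : ∀ w, ‖dirD 1 φ w‖ ≤ K / r ∧ ‖dirD Complex.I φ w‖ ≤ K / r
  norm_lap_le : ∀ w, ‖lap φ w‖ ≤ K / r ^ 2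

lemma exists_isCutoff : ∃ K, 0 ≤ K ∧ ∀ (b : ℂ) {r : ℝ}, 0 < r → ∃ φ, IsCutoff K b r φ := by
  let B : ContDiffBump (0 : ℂ) := ⟨1, 3 / 2, by norm_num, by norm_num⟩
  let Φ : ℂ → ℂ := fun w => (B w : ℂ)
  have hΦ : ContDiff ℝ 2 Φ := Complex.ofRealCLM.contDiff.comp B.contDiff
  have hΦ0 : ∀ w, 3 / 2 ≤ ‖w‖ → Φ w = 0 := fun w hw => by
    simp only [Φ, Complex.ofReal_eq_zero]
    exact B.zero_of_le_dist (by simpa using hw)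
  have hc : HasCompactSupport Φ :=
    HasCompactSupport.of_support_subset_isCompact (isCompact_closedBall 0 (3 / 2)) fun w hw => by
      by_contra h
      rw [mem_closedBall_zero_iff, not_le] at h
      exact hw (hΦ0 w h.le)
  obtain ⟨K, hK⟩ := exists_forall_norm_dirD_le hΦ hc
  obtain ⟨L, hL⟩ := (hΦ.of_le (m := 1) (by norm_num)).lipschitzWith_of_hasCompactSupport hc
    (by norm_num)
  have hK0 : 0 ≤ K := (norm_nonneg _).trans (hK 0).1
  refine ⟨max K L, hK0.trans (le_max_left _ _), fun b r hr => ?_⟩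
  have hn : ‖((r⁻¹ : ℝ) : ℂ)‖ = r⁻¹ := by
    rw [Complex.norm_real, Real.norm_of_nonneg (inv_nonneg.2 hr.le)]
  have hdir : ∀ e, (∀ w, ‖dirD e Φ w‖ ≤ K) → ∀ w,
      ‖dirD e (fun w => Φ (r⁻¹ • (w - b))) w‖ ≤ max K L / r := fun e he w => by
    rw [dirD_comp_smul_sub (hΦ.differentiable (by norm_num)), norm_mul, hn, inv_mul_eq_div]
    gcongr
    exact (he _).trans (le_max_left _ _)
  refine ⟨fun w => Φ (r⁻¹ • (w - b)), ⟨?_, ?_, fun w hw => ?_, fun w => ?_, fun x y => ?_,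
    fun w => ⟨hdir _ (fun w => (hK w).1) w, hdir _ (fun w => (hK w).2.1) w⟩, fun w => ?_⟩⟩
  · exact hΦ.comp ((contDiff_id.sub contDiff_const).const_smul r⁻¹)
  · refine (closure_minimal (fun w hw => ?_) (isClosed_closedBall (x := b) (ε := 3 / 2 * r))).trans
      (closedBall_subset_ball (by linarith))
    by_contra h
    rw [mem_closedBall_iff_norm, not_le] at h
    refine hw (hΦ0 _ ?_)
    rw [norm_smul, Real.norm_of_nonneg (inv_nonneg.2 hr.le), inv_mul_eq_div, le_div_iff₀ hr]
    exact h.le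
  · simp only [Φ]
    rw [B.one_of_mem_closedBall, Complex.ofReal_one]
    rw [mem_closedBall_zero_iff, norm_smul, Real.norm_of_nonneg (inv_nonneg.2 hr.le),
      inv_mul_eq_div, div_le_iff₀ hr]
    rw [mem_ball_iff_norm] at hw
    simpa [B] using hw.le
  · simp only [Φ, Complex.norm_real]
    rw [Real.norm_of_nonneg B.nonneg]
    exact B.le_one
  · have h1 := hL.dist_le_mul (r⁻¹ • (x - b)) (r⁻¹ • (y - b))
    rw [dist_eq_norm, dist_eq_norm, ← smul_sub, sub_sub_sub_cancel_right, norm_smul,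
      Real.norm_of_nonneg (inv_nonneg.2 hr.le)] at h1
    refine h1.trans ?_
    rw [← mul_assoc, ← div_eq_mul_inv]
    gcongr
    exact le_max_right _ _
  · rw [lap_comp_smul_sub hΦ, norm_mul, norm_pow, hn, inv_pow, inv_mul_eq_div]
    gcongr
    exact (hK _).2.2.trans (le_max_left _ _)

lemma IsCutoff.eq_zero {K : ℝ} {b : ℂ} {r : ℝ} {φ : ℂ → ℂ} (h : IsCutoff K b r φ) {w : ℂ}
    (hw : w ∉ ball b (2 * r)) : φ w = 0 :=
  image_eq_zero_of_notMem_tsupport fun h1 => hw (h.tsupport_subset h1)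

lemma IsCutoff.norm_mul_sub_le {K : ℝ} {b : ℂ} {r : ℝ} {φ : ℂ → ℂ} (h : IsCutoff K b r φ)
    (hK : 0 ≤ K) (hr : 0 < r) {α η : ℝ} (hα0 : 0 < α) (hα1 : α < 1) (hη : 0 ≤ η) {E : Set ℂ}
    {F : ℂ → ℂ} (hF : ∀ x ∈ E, ∀ y ∈ E, ‖x - y‖ ≤ 4 * r → ‖F x - F y‖ ≤ η * ‖x - y‖ ^ α)
    (hb : b ∈ E) (hFb : F b = 0) {x y : ℂ} (hx : x ∈ E) (hy : y ∈ E) :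
    ‖φ x * F x - φ y * F y‖ ≤ (1 + 4 * K) * η * ‖x - y‖ ^ α := by
  have hsmall : ∀ z ∈ E, z ∈ ball b (2 * r) → ‖F z‖ ≤ η * (2 * r) ^ α := fun z hz hzb => by
    rw [mem_ball_iff_norm] at hzb
    have h1 := hF z hz b hb (by linarith)
    rw [hFb, sub_zero] at h1
    exact h1.trans (by gcongr)
  by_cases hxy : x ∈ ball b (2 * r) ∨ y ∈ ball b (2 * r)
  · wlog hyb : y ∈ ball b (2 * r) generalizing x y
    · rw [norm_sub_rev, norm_sub_rev x]
      exact this hy hx hxy.symm (hxy.resolve_right hyb)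
    rcases le_or_gt ‖x - y‖ (4 * r) with hle | hlt
    · have h1 : φ x * F x - φ y * F y = φ x * (F x - F y) + (φ x - φ y) * F y := by ring
      have h2 : ‖φ x * (F x - F y)‖ ≤ 1 * (η * ‖x - y‖ ^ α) := by
        rw [norm_mul]
        exact mul_le_mul (h.norm_le_one x) (hF x hx y hy hle) (norm_nonneg _) zero_le_one
      have h3 : ‖(φ x - φ y) * F y‖ ≤ K / r * ‖x - y‖ * (η * (2 * r) ^ α) := by
        rw [norm_mul]
        exact mul_le_mul (h.norm_map_sub_le x y) (hsmall y hy hyb) (norm_nonneg _) (by positivity)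
      have h4 := Real.rpow_le_rpow_sub_mul_rpow (norm_nonneg _) hle hα0.le hα1.le
      rw [Real.rpow_one] at h4
      have h5 : (4 * r) ^ (1 - α) * (2 * r) ^ α ≤ 4 * r := by
        calc (4 * r) ^ (1 - α) * (2 * r) ^ α ≤ (4 * r) ^ (1 - α) * (4 * r) ^ α := by
              gcongr; norm_num
          _ = 4 * r := by rw [← Real.rpow_add (by positivity), sub_add_cancel, Real.rpow_one]
      have h6 : K / r * ‖x - y‖ * (η * (2 * r) ^ α) ≤ 4 * K * η * ‖x - y‖ ^ α := by
        calc K / r * ‖x - y‖ * (η * (2 * r) ^ α)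
            ≤ K / r * ((4 * r) ^ (1 - α) * ‖x - y‖ ^ α) * (η * (2 * r) ^ α) := by gcongr
          _ = K / r * η * ‖x - y‖ ^ α * ((4 * r) ^ (1 - α) * (2 * r) ^ α) := by ring
          _ ≤ K / r * η * ‖x - y‖ ^ α * (4 * r) := by gcongr
          _ = 4 * K * η * ‖x - y‖ ^ α := by field_simp
      rw [h1]
      refine (norm_add_le _ _).trans ?_
      linarith
    · have hxb : x ∉ ball b (2 * r) := fun hxb => by
        rw [mem_ball_iff_norm] at hxb hyb
        have := norm_sub_le_norm_sub_add_norm_sub x b y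
        rw [norm_sub_rev b] at this
        linarith
      rw [h.eq_zero hxb, zero_mul, zero_sub, norm_neg, norm_mul]
      calc ‖φ y‖ * ‖F y‖ ≤ 1 * (η * (2 * r) ^ α) :=
            mul_le_mul (h.norm_le_one y) (hsmall y hy hyb) (norm_nonneg _) zero_le_one
        _ ≤ 1 * η * ‖x - y‖ ^ α := by
            rw [mul_assoc]
            gcongr
            linarith
        _ ≤ (1 + 4 * K) * η * ‖x - y‖ ^ α := by
            gcongr
            linarith
  · rw [not_or] at hxy
    rw [h.eq_zero hxy.1, h.eq_zero hxy.2]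
    simp only [zero_mul, sub_zero, norm_zero]
    positivity

lemma exists_norm_locT_sub_le {β : ℝ} (hβ0 : 0 < β) (hβ1 : β < 1) :
    ∃ C, 0 ≤ C ∧ ∀ {K : ℝ} {b : ℂ} {r : ℝ} {φ : ℂ → ℂ}, IsCutoff K b r φ → 0 ≤ K → 0 < r →
      ∀ {H : ℂ → ℂ} {M : ℝ}, AEStronglyMeasurable H volume → 0 ≤ M →
      (∀ w ∈ ball b (2 * r), ‖H w‖ ≤ M) → ∀ x y,
      ‖locT φ H x - locT φ H y‖ ≤ C * K * M * (2 * r) ^ (-β) * ‖x - y‖ ^ β := by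
  obtain ⟨C₁, hC₁, h₁⟩ := exists_norm_dirT_sub_le hβ0 hβ1
  obtain ⟨C₂, hC₂, h₂⟩ := exists_norm_logT_sub_le hβ0 hβ1
  refine ⟨8 * C₁ + 4 * C₂, by positivity, fun {K b r φ} h hK hr {H M} hH hM hHb x y => ?_⟩
  have hr2 : 0 < 2 * r := by positivity
  have a1 := h₁ (e := 1) (by simp) (isDensity_mul_dirD h.contDiff h.tsupport_subset hH hM hHb 1
    fun w => (h.norm_dirD_le w).1) hr2 x y
  have a2 := h₁ (e := Complex.I) (by simp) (isDensity_mul_dirD h.contDiff h.tsupport_subset hH hM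
    hHb Complex.I fun w => (h.norm_dirD_le w).2) hr2 x y
  have a3 := h₂ (isDensity_mul_lap h.contDiff h.tsupport_subset hH hM hHb h.norm_lap_le) hr2 x y
  have e1 : C₁ * (M * (K / r)) * (2 * r) ^ (1 - β) * ‖x - y‖ ^ β =
      2 * C₁ * K * M * (2 * r) ^ (-β) * ‖x - y‖ ^ β := by
    rw [sub_eq_add_neg, Real.rpow_add hr2, Real.rpow_one]
    field_simp
  have e2 : C₂ * (M * (K / r ^ 2)) * (2 * r) ^ (2 - β) * ‖x - y‖ ^ β =
      4 * C₂ * K * M * (2 * r) ^ (-β) * ‖x - y‖ ^ β := by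
    rw [sub_eq_add_neg, Real.rpow_add hr2, Real.rpow_two]
    field_simp
    ring
  rw [e1] at a1 a2
  rw [e2] at a3
  have e3 : ∀ p q s p' q' s' : ℂ, ‖2 * p + 2 * q - s - (2 * p' + 2 * q' - s')‖ ≤
      2 * ‖p - p'‖ + 2 * ‖q - q'‖ + ‖s - s'‖ := fun p q s p' q' s' => by
    have : 2 * p + 2 * q - s - (2 * p' + 2 * q' - s') =
      2 * (p - p') + 2 * (q - q') - (s - s') := by ring
    rw [this]
    refine (norm_sub_le _ _).trans (add_le_add_left ((norm_add_le _ _).trans ?_) _)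
    simp
  refine (e3 _ _ _ _ _ _).trans ?_
  linarith

lemma LittleHolderOn.of_norm_sub_le {α β D A C : ℝ} {E : Set ℂ} {f g : ℂ → ℂ} (hα : 0 < α)
    (hαβ : α < β) (hA : 0 ≤ A) (hC : 0 ≤ C) (hD : ∀ x ∈ E, ∀ y ∈ E, ‖x - y‖ ≤ D)
    (hf : LittleHolderOn α E f)
    (h : ∀ x ∈ E, ∀ y ∈ E, ‖g x - g y‖ ≤ A * ‖f x - f y‖ + C * ‖x - y‖ ^ β) :
    LittleHolderOn α E g := by
  rw [littleHolderOn_iff hα] at hf ⊢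
  obtain ⟨⟨C₀, hC₀⟩, hf⟩ := hf
  refine ⟨⟨A * C₀ + C * D ^ (β - α), fun x hx y hy => ?_⟩, fun η hη => ?_⟩
  · have h1 := Real.rpow_le_rpow_sub_mul_rpow (norm_nonneg _) (hD x hx y hy) hα.le hαβ.le
    calc ‖g x - g y‖ ≤ A * ‖f x - f y‖ + C * ‖x - y‖ ^ β := h x hx y hy
      _ ≤ A * (C₀ * ‖x - y‖ ^ α) + C * (D ^ (β - α) * ‖x - y‖ ^ α) := by
          gcongr
          exact hC₀ x hx y hy
      _ = _ := by ring
  · obtain ⟨δ, hδ, h1⟩ := hf (η / (2 * (A + 1))) (by positivity)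
    set δ' : ℝ := (η / (2 * (C + 1))) ^ (β - α)⁻¹ with hδ'
    have hδ'0 : 0 < δ' := by positivity
    have hδ'p : δ' ^ (β - α) = η / (2 * (C + 1)) := by
      rw [hδ', ← Real.rpow_mul (by positivity), inv_mul_cancel₀ (sub_pos.2 hαβ).ne',
        Real.rpow_one]
    refine ⟨min δ δ', lt_min hδ hδ'0, fun x hx y hy hxy => ?_⟩
    have h2 := h1 x hx y hy (hxy.trans (min_le_left _ _))
    have h3 := Real.rpow_le_rpow_sub_mul_rpow (norm_nonneg _) (hxy.trans (min_le_right _ _))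
      hα.le hαβ.le
    rw [hδ'p] at h3
    have h4 : A * (η / (2 * (A + 1))) ≤ η / 2 := by
      rw [mul_div_assoc', div_le_div_iff₀ (by positivity) (by positivity)]
      nlinarith
    have h5 : C * (η / (2 * (C + 1))) ≤ η / 2 := by
      rw [mul_div_assoc', div_le_div_iff₀ (by positivity) (by positivity)]
      nlinarith
    have ht : 0 ≤ ‖x - y‖ ^ α := by positivity
    calc ‖g x - g y‖ ≤ A * ‖f x - f y‖ + C * ‖x - y‖ ^ β := h x hx y hy
      _ ≤ A * (η / (2 * (A + 1)) * ‖x - y‖ ^ α) + C * (η / (2 * (C + 1)) * ‖x - y‖ ^ α) := by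
          gcongr
      _ = A * (η / (2 * (A + 1))) * ‖x - y‖ ^ α + C * (η / (2 * (C + 1))) * ‖x - y‖ ^ α := by
          ring
      _ ≤ η / 2 * ‖x - y‖ ^ α + η / 2 * ‖x - y‖ ^ α := by gcongr
      _ = η * ‖x - y‖ ^ α := by ring

lemma HarmonicOnC.exists_contDiff_eqOn {F : ℂ → ℂ} {U : Set ℂ} (hF : HarmonicOnC F U)
    (hU : IsOpen U) {z₀ : ℂ} (hz₀ : z₀ ∈ U) :
    ∃ G : ℂ → ℂ, ∃ s > 0, ContDiff ℝ 2 G ∧ HasCompactSupport G ∧ ball z₀ s ⊆ U ∧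
      EqOn G F (ball z₀ s) := by
  obtain ⟨s, hs, hsU⟩ := nhds_basis_closedBall.mem_iff.1 (hU.mem_nhds hz₀)
  let B : ContDiffBump z₀ := ⟨s / 2, s, half_pos hs, half_lt_self hs⟩
  let χ : ℂ → ℂ := fun w => (B w : ℂ)
  have hχ : ContDiff ℝ 2 χ := Complex.ofRealCLM.contDiff.comp B.contDiff
  have hχs : tsupport χ ⊆ closedBall z₀ s :=
    closure_minimal (fun w hw => by
      by_contra h
      rw [mem_closedBall, not_le] at h
      exact hw (by simpa [χ] using B.zero_of_le_dist h.le)) isClosed_closedBall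
  have hχc : HasCompactSupport χ :=
    (isCompact_closedBall z₀ s).of_isClosed_subset (isClosed_tsupport _) hχs
  refine ⟨fun w => χ w * F w, s / 2, half_pos hs, contDiff_iff_contDiffAt.2 fun x => ?_,
    hχc.mul_right, (ball_subset_closedBall.trans (closedBall_subset_closedBall (by linarith))).trans
      hsU, fun w hw => ?_⟩
  · by_cases hx : x ∈ U
    · exact hχ.contDiffAt.mul (hF.1.contDiffAt (hU.mem_nhds hx))
    · have h1 := notMem_tsupport_iff_eventuallyEq.1 fun h => hx (hsU (hχs h))
      refine (contDiffAt_const (c := (0 : ℂ))).congr_of_eventuallyEq ?_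
      filter_upwards [h1] with w hw
      simp [hw]
  · have : B w = 1 := B.one_of_mem_closedBall (ball_subset_closedBall hw)
    simp [χ, this]

section
variable {K : ℝ} {b : ℂ} {r : ℝ} {φ : ℂ → ℂ} {U : Set ℂ} {F : ℂ → ℂ} {A : ℝ}

/-- Subtracting the potential of the localisation keeps harmonicity where `F` is harmonic. -/
lemma IsCutoff.harmonicAt_sub_add_locT (h : IsCutoff K b r φ) (hU : IsOpen U)
    (hF : HarmonicOnC F U) (hFm : AEStronglyMeasurable (U.indicator F) volume)
    (hFb : ∀ w, ‖U.indicator F w‖ ≤ A) {z₀ : ℂ} (hz₀ : z₀ ∈ U) :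
    HarmonicAt (fun x => F x - φ x * F x + (2 * Real.pi : ℂ)⁻¹ * locT φ (U.indicator F) x) z₀ := by
  obtain ⟨G, s, hs, hG, hGc, hsU, hGF⟩ := hF.exists_contDiff_eqOn hU hz₀
  have hc : HasCompactSupport φ :=
    (isCompact_closedBall b (2 * r)).of_isClosed_subset (isClosed_tsupport _)
      (h.tsupport_subset.trans ball_subset_closedBall)
  obtain ⟨A', hA'⟩ := hGc.exists_bound_of_continuous hG.continuous
  let D : ℂ → ℂ := fun w => U.indicator F w - G w
  have hDm : AEStronglyMeasurable D volume := hFm.sub hG.continuous.aestronglyMeasurable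
  have hDb : ∀ w, ‖D w‖ ≤ A + A' := fun w =>
    (norm_sub_le _ _).trans (add_le_add (hFb w) (hA' w))
  have hD0 : ∀ w ∈ ball z₀ s, D w = 0 := fun w hw => by
    simp only [D]
    rw [indicator_of_mem (hsU hw), hGF hw, sub_self]
  have hadd : ∀ x, locT φ (U.indicator F) x = locT φ G x + locT φ D x := fun x => by
    rw [← locT_add h.contDiff h.tsupport_subset hG.continuous.aestronglyMeasurable hA' hDm hDb]
    simp [D]
  have hlap : ∀ w ∈ ball z₀ s, φ w * lap G w = 0 := fun w hw => by
    have h1 : G =ᶠ[𝓝 w] F := hGF.eventuallyEq_of_mem (isOpen_ball.mem_nhds hw)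
    have h2 : lap F w = 0 := hF.2 w (hsU hw)
    rw [(lap_congr h1).eq_of_nhds, h2, mul_zero]
  obtain ⟨M, R, hρ⟩ := h.contDiff.continuous.exists_isDensity_mul (continuous_lap hG) (.inl hc)
  have hpi : (2 * Real.pi : ℂ) ≠ 0 := by simp [Real.pi_ne_zero]
  have heq : (fun x => F x - φ x * F x + (2 * Real.pi : ℂ)⁻¹ * locT φ (U.indicator F) x) =ᶠ[𝓝 z₀]
      fun x => F x - (2 * Real.pi : ℂ)⁻¹ * logT (fun w => φ w * lap G w) x +
        (2 * Real.pi : ℂ)⁻¹ * locT φ D x := by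
    filter_upwards [ball_mem_nhds z₀ hs] with x hx
    have h1 := locT_add_logT h.contDiff hc hG x
    rw [hadd, eq_sub_of_add_eq h1, hGF hx]
    field_simp
    ring
  rw [InnerProductSpace.harmonicAt_congr_nhds heq]
  refine ((hF.harmonicAt hU hz₀).sub (HarmonicAt.const_mul ?_ _)).add (HarmonicAt.const_mul ?_ _)
  · exact hρ.harmonicAt_logT hs hlap
  · exact harmonicAt_locT h.contDiff h.tsupport_subset hDm hDb hs fun w hw => .inl (hD0 w hw)

lemma IsCutoff.harmonicAt_locT_of_mem_ball (h : IsCutoff K b r φ) {H : ℂ → ℂ}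
    (hH : AEStronglyMeasurable H volume) (hHb : ∀ w, ‖H w‖ ≤ A) {z₀ : ℂ} (hz₀ : z₀ ∈ ball b r) :
    HarmonicAt (locT φ H) z₀ := by
  obtain ⟨s, hs, hsb⟩ := Metric.isOpen_iff.1 isOpen_ball z₀ hz₀
  refine harmonicAt_locT h.contDiff h.tsupport_subset hH hHb hs fun w hw => .inr ?_
  have h1 : φ =ᶠ[𝓝 w] fun _ => 1 := by
    filter_upwards [isOpen_ball.mem_nhds (hsb hw)] with x hx using h.eq_one x hx
  have h2 : ∀ e, (dirD e fun _ => (1 : ℂ)) = fun _ => 0 := fun e => by ext w; simp [dirD]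
  have h3 : ∀ e, (dirD e fun _ => (0 : ℂ)) = fun _ => 0 := fun e => by ext w; simp [dirD]
  rw [(dirD_congr h1 _).eq_of_nhds, (dirD_congr h1 _).eq_of_nhds, (lap_congr h1).eq_of_nhds]
  simp [lap, h2, h3]

end

/-- For `0 < α < 1`, `U ⊆ ℂ` bounded and open and `b ∈ ∂U`, the space
`H^α_b(U)` is dense in `H^α(U)`. -/
theorem statement0 (α : ℝ) (hα0 : 0 < α) (hα1 : α < 1)
    (U : Set ℂ) (hUopen : IsOpen U) (hUbdd : Bornology.IsBounded U)
    (b : ℂ) (hb : b ∈ frontier U)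
    (f : ℂ → ℂ) (hf : MemHalpha α U f) (ε : ℝ) (hε : 0 < ε) :
    ∃ g : ℂ → ℂ, MemHalphaB α U b g ∧ HNorm α U (fun z => f z - g z) < ε := by
  have hbE : b ∈ closure U := frontier_subset_closure hb
  obtain ⟨D, hD⟩ := isBounded_iff.1 hUbdd.closure
  have hD' : ∀ x ∈ closure U, ∀ y ∈ closure U, ‖x - y‖ ≤ D := fun x hx y hy => by
    rw [← dist_eq_norm]
    exact hD hx hy
  have hD0 : 0 ≤ D := (norm_nonneg _).trans (hD' b hbE b hbE)
  obtain ⟨⟨C₀, hC₀⟩, hlittle⟩ := (littleHolderOn_iff hα0).1 hf.2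
  obtain ⟨K, hK0, hK⟩ := exists_isCutoff
  obtain ⟨C, hC0, hC⟩ := exists_norm_locT_sub_le hα0 hα1
  set B : ℝ := (1 + 4 * K) + C * K with hB
  have hB0 : 0 < B := by positivity
  set η : ℝ := ε / (2 * B * (D ^ α + 1)) with hη
  have hη0 : 0 < η := by positivity
  obtain ⟨δ, hδ, hfδ⟩ := hlittle η hη0
  set r : ℝ := δ / 4 with hr
  have hr0 : 0 < r := by positivity
  obtain ⟨φ, hφ⟩ := hK b hr0
  set F : ℂ → ℂ := fun z => f z - f b with hF
  have hFsub : ∀ x y, F x - F y = f x - f y := fun x y => sub_sub_sub_cancel_right _ _ _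
  have hFδ : ∀ x ∈ closure U, ∀ y ∈ closure U, ‖x - y‖ ≤ 4 * r →
      ‖F x - F y‖ ≤ η * ‖x - y‖ ^ α := fun x hx y hy hxy => by
    rw [hFsub]
    exact hfδ x hx y hy (by linarith)
  have hFb : F b = 0 := sub_self _
  have hFharm : HarmonicOnC F U := harmonicOnC_of_harmonicAt fun z hz =>
    (hf.1.harmonicAt hUopen hz).sub (InnerProductSpace.harmonicAt_const _)
  set A : ℝ := |C₀| * D ^ α with hA
  have hA0 : 0 ≤ A := by positivity
  have hFA : ∀ x ∈ closure U, ‖F x‖ ≤ A := fun x hx => by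
    refine (hC₀ x hx b hbE).trans ?_
    have := hD' x hx b hbE
    exact mul_le_mul (le_abs_self _) (by gcongr) (by positivity) (abs_nonneg _)
  set H : ℂ → ℂ := U.indicator F with hH
  have hHm : AEStronglyMeasurable H volume :=
    (aestronglyMeasurable_indicator_iff hUopen.measurableSet).2
      (hFharm.1.continuousOn.aestronglyMeasurable hUopen.measurableSet)
  have hHA : ∀ w, ‖H w‖ ≤ A := fun w => by
    by_cases hw : w ∈ U
    · rw [hH, indicator_of_mem hw]
      exact hFA w (subset_closure hw)
    · rw [hH, indicator_of_notMem hw, norm_zero]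
      exact hA0
  have hHsmall : ∀ w ∈ ball b (2 * r), ‖H w‖ ≤ η * (2 * r) ^ α := fun w hw => by
    by_cases hwU : w ∈ U
    · rw [mem_ball_iff_norm] at hw
      have h1 := hFδ w (subset_closure hwU) b hbE (by linarith)
      rw [hFb, sub_zero] at h1
      rw [hH, indicator_of_mem hwU]
      exact h1.trans (by gcongr)
    · rw [hH, indicator_of_notMem hwU, norm_zero]
      positivity
  set u : ℂ → ℂ := fun x => (2 * Real.pi : ℂ)⁻¹ * locT φ H x with hu
  have husub : ∀ x y, ‖u x - u y‖ ≤ ‖locT φ H x - locT φ H y‖ := fun x y => by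
    simp only [hu]
    rw [← mul_sub, norm_mul]
    refine mul_le_of_le_one_left (norm_nonneg _) ?_
    rw [norm_inv]
    refine inv_le_one_of_one_le₀ ?_
    rw [norm_mul, Complex.norm_real, Real.norm_of_nonneg Real.pi_pos.le]
    simp only [Complex.norm_ofNat]
    linarith [Real.pi_gt_three]
  have huα : ∀ x y, ‖u x - u y‖ ≤ C * K * η * ‖x - y‖ ^ α := fun x y => by
    refine (husub x y).trans ((hC hφ hK0 hr0 hHm (by positivity) hHsmall x y).trans_eq ?_)
    have : (2 * r) ^ α * (2 * r) ^ (-α) = 1 := by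
      rw [← Real.rpow_add (by positivity), add_neg_cancel, Real.rpow_zero]
    linear_combination C * K * η * ‖x - y‖ ^ α * this
  set g : ℂ → ℂ := fun x => F x - φ x * F x + u x + (f b - u b) with hg
  have hv : ∀ x y, (f x - g x) - (f y - g y) = (φ x * F x - φ y * F y) - (u x - u y) :=
    fun x y => by
      simp only [hg]
      linear_combination -(hFsub x y)
  have hvα : ∀ x ∈ closure U, ∀ y ∈ closure U,
      ‖(f x - g x) - (f y - g y)‖ ≤ B * η * ‖x - y‖ ^ α := fun x hx y hy => by
    rw [hv]
    refine (norm_sub_le _ _).trans ?_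
    have h1 := hφ.norm_mul_sub_le hK0 hr0 hα0 hα1 hη0.le hFδ hbE hFb hx hy
    have h2 := huα x y
    rw [hB]
    linarith
  have hgU : ∀ z ∈ U, HarmonicAt g z := fun z hz =>
    (hφ.harmonicAt_sub_add_locT hUopen hFharm hHm hHA hz).add
      (InnerProductSpace.harmonicAt_const _)
  have hgb : ∀ z ∈ ball b r, HarmonicAt g z := fun z hz => by
    have heq : g =ᶠ[𝓝 z] fun x => u x + (f b - u b) := by
      filter_upwards [isOpen_ball.mem_nhds hz] with x hx
      simp only [hg, hφ.eq_one x hx]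
      ring
    rw [InnerProductSpace.harmonicAt_congr_nhds heq]
    exact (HarmonicAt.const_mul (hφ.harmonicAt_locT_of_mem_ball hHm hHA hz) _).add
      (InnerProductSpace.harmonicAt_const _)
  refine ⟨g, ⟨⟨harmonicOnC_of_harmonicAt hgU, ?_⟩, r, hr0, g,
    harmonicOnC_of_harmonicAt fun z hz => hz.elim (hgU z) (hgb z), fun _ _ => rfl⟩, ?_⟩
  · obtain ⟨C', hC'0, hC'⟩ := exists_norm_locT_sub_le (β := (1 + α) / 2) (by linarith) (by linarith)
    refine LittleHolderOn.of_norm_sub_le (β := (1 + α) / 2) (A := 2)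
      (C := K / r * A * D ^ (1 - (1 + α) / 2) + C' * K * A * (2 * r) ^ (-((1 + α) / 2)))
      hα0 (by linarith) zero_le_two (by positivity) hD' hf.2 fun x hx y hy => ?_
    have h1 := (husub x y).trans (hC' hφ hK0 hr0 hHm hA0 (fun w _ => hHA w) x y)
    have h2 : g x - g y = (F x - F y) - φ x * (F x - F y) - (φ x - φ y) * F y + (u x - u y) := by
      simp only [hg]
      ring
    have h3 : ‖φ x * (F x - F y)‖ ≤ ‖F x - F y‖ := by
      rw [norm_mul]
      exact mul_le_of_le_one_left (norm_nonneg _) (hφ.norm_le_one x)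
    have h4 : ‖(φ x - φ y) * F y‖ ≤
        K / r * (D ^ (1 - (1 + α) / 2) * ‖x - y‖ ^ ((1 + α) / 2)) * A := by
      have h5 := Real.rpow_le_rpow_sub_mul_rpow (α := (1 + α) / 2) (β := 1) (norm_nonneg _)
        (hD' x hx y hy) (by linarith) (by linarith)
      rw [Real.rpow_one] at h5
      rw [norm_mul]
      refine mul_le_mul ((hφ.norm_map_sub_le x y).trans ?_) (hFA y hy) (norm_nonneg _) (by positivity)
      gcongr
    rw [h2]
    rw [hFsub] at h3 ⊢
    refine (norm_add_le _ _).trans ((add_le_add_left ((norm_sub_le _ _).trans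
      (add_le_add_left (norm_sub_le _ _) _)) _).trans ?_)
    linarith
  · have h1 := HNorm_le (α := α) (U := U) (v := fun z => f z - g z) (A := B * η * D ^ α)
      (B := B * η) (by positivity) (by positivity) (fun x hx => ?_) hvα
    · refine h1.trans_lt ?_
      have : B * η * D ^ α + B * η = ε / 2 := by
        rw [hη]
        field_simp
      rw [this]
      exact half_lt_self hε
    · have hvb : f b - g b = 0 := by
        simp only [hg, hFb]
        ring
      have h2 := hvα x hx b hbE
      rw [hvb, sub_zero] at h2
      have := hD' x hx b hbE
      exact h2.trans (by gcongr)

end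
end

section
/- Let k ∈ ℕ be given. There exists a positive constant K (depending only on k) such that whenever E ⊆ ℝ² is compact and E ⊆ ∪_{n=1}^∞ S_n, where each S_n is a closed dyadic square of side at most 1, there exists a sequence (φ_n)_n of smooth compactly supported functions φ_n : ℝ² → ℝ such that: (1) φ_n = 0 for all but finitely many n; (2) Σ_n φ_n = 1 on a neighbourhood of E; (3) N_k(φ_n) ≤ K for all n; and (4) supp(φ_n) ⊆ 5·S_n for every n. -/
open Metric Set Filter

noncomputable section

/-- The closed dyadic square `[j·2^{-m}, (j+1)·2^{-m}] × [l·2^{-m}, (l+1)·2^{-m}]`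
in `ℝ²`. -/
def dyadicSq (m j l : ℤ) : Set (EuclideanSpace ℝ (Fin 2)) :=
  {x | x 0 ∈ Set.Icc ((j : ℝ) * 2 ^ (-m)) (((j : ℝ) + 1) * 2 ^ (-m)) ∧
       x 1 ∈ Set.Icc ((l : ℝ) * 2 ^ (-m)) (((l : ℝ) + 1) * 2 ^ (-m))}

/-- The square with the same centre as `dyadicSq m j l` and `λ` times the side. -/
def scaledDyadicSq (lam : ℝ) (m j l : ℤ) : Set (EuclideanSpace ℝ (Fin 2)) :=
  {x | x 0 ∈ Set.Icc (((j : ℝ) + 1 / 2 - lam / 2) * 2 ^ (-m))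
                     (((j : ℝ) + 1 / 2 + lam / 2) * 2 ^ (-m)) ∧
       x 1 ∈ Set.Icc (((l : ℝ) + 1 / 2 - lam / 2) * 2 ^ (-m))
                     (((l : ℝ) + 1 / 2 + lam / 2) * 2 ^ (-m))}

/-- `N_k(φ) = d(φ)^k · sup_x ‖∇^k φ(x)‖`, where `d(φ)` is the diameter of the support. -/
def Nk {E F : Type*} [NormedAddCommGroup E] [NormedSpace ℝ E]
    [NormedAddCommGroup F] [NormedSpace ℝ F] (k : ℕ) (φ : E → F) : ℝ :=
  Metric.diam (tsupport φ) ^ k * ⨆ x, ‖iteratedFDeriv ℝ k φ x‖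

/-- If the derivatives of each factor are dominated by the powers of a weight, then those of the
product are dominated by the powers of the total weight. -/
lemma norm_iteratedFDeriv_prod_le_sum_pow {ι E : Type*} [NormedAddCommGroup E] [NormedSpace ℝ E]
    {u : Finset ι} {f : ι → E → ℝ} {w : ι → ℝ} {x : E} {n : ℕ}
    (hf : ∀ i ∈ u, ContDiff ℝ n (f i))
    (hw : ∀ i ∈ u, ∀ a ≤ n, ‖iteratedFDeriv ℝ a (f i) x‖ ≤ w i ^ a) :
    ‖iteratedFDeriv ℝ n (fun y ↦ ∏ i ∈ u, f i y) x‖ ≤ (∑ i ∈ u, w i) ^ n := by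
  classical
  refine (norm_iteratedFDeriv_prod_le hf le_rfl).trans ?_
  rw [Finset.sum_pow]
  refine Finset.sum_le_sum fun p hp ↦ mul_le_mul_of_nonneg_left ?_ (Nat.cast_nonneg _)
  obtain ⟨q, hq⟩ := p
  have hqu : q.toFinset ⊆ u := fun i hi ↦
    Finset.mem_sym_iff.1 hp i (Multiset.mem_toFinset.1 hi)
  change ∏ i ∈ u, ‖iteratedFDeriv ℝ (q.count i) (f i) x‖ ≤ (q.map w).prod
  rw [Finset.prod_multiset_map_count, Finset.prod_subset hqu fun i _ hi ↦ by
    rw [Multiset.count_eq_zero_of_notMem (by simpa using hi), pow_zero]]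
  exact Finset.prod_le_prod (fun _ _ ↦ norm_nonneg _) fun i hi ↦
    hw i hi _ ((Multiset.count_le_card _ _).trans_eq hq)

/-- The centre of `dyadicSq m j l` after rescaling by `2 ^ m`. -/
def dyadicCentre (j l : ℤ) : EuclideanSpace ℝ (Fin 2) :=
  !₂[(j : ℝ) + 1 / 2, (l : ℝ) + 1 / 2]

/-- The disc concentric with `dyadicSq m j l`, with radius `5 / 2` times its side. -/
def dyadicDisc (m j l : ℤ) : Set (EuclideanSpace ℝ (Fin 2)) :=
  {x | ‖(2 : ℝ) ^ m • x - dyadicCentre j l‖ ≤ 5 / 2}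

/-- A bump function at the unit scale. -/
def unitBump : ContDiffBump (0 : EuclideanSpace ℝ (Fin 2)) where
  rIn := 1
  rOut := 5 / 2
  rIn_pos := one_pos
  rIn_lt_rOut := by norm_num

/-- The rescaled bump function adapted to `dyadicSq m j l`. -/
def dyadicBump (m j l : ℤ) (x : EuclideanSpace ℝ (Fin 2)) : ℝ :=
  unitBump ((2 : ℝ) ^ m • x - dyadicCentre j l)

lemma norm_smul_sub_dyadicCentre_lt {m j l : ℤ} {x : EuclideanSpace ℝ (Fin 2)}
    (hx : x ∈ dyadicSq m j l) : ‖(2 : ℝ) ^ m • x - dyadicCentre j l‖ < 1 := by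
  obtain ⟨⟨h1, h2⟩, h3, h4⟩ := hx
  have hm : (0 : ℝ) < 2 ^ m := by positivity
  rw [zpow_neg, ← div_eq_mul_inv] at h1 h2 h3 h4
  rw [div_le_iff₀ hm] at h1 h3
  rw [le_div_iff₀ hm] at h2 h4
  rw [EuclideanSpace.norm_eq, Real.sqrt_lt' one_pos]
  simp only [Fin.sum_univ_two, Real.norm_eq_abs, sq_abs, dyadicCentre, PiLp.sub_apply,
    PiLp.smul_apply, smul_eq_mul, Matrix.cons_val_zero, Matrix.cons_val_one]
  nlinarith

lemma abs_sub_le_of_mem_dyadicDisc {m j l : ℤ} {x : EuclideanSpace ℝ (Fin 2)}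
    (hx : x ∈ dyadicDisc m j l) :
    |(2 : ℝ) ^ m * x 0 - (j + 1 / 2)| ≤ 5 / 2 ∧ |(2 : ℝ) ^ m * x 1 - (l + 1 / 2)| ≤ 5 / 2 := by
  have h (i) := (PiLp.norm_apply_le ((2 : ℝ) ^ m • x - dyadicCentre j l) i).trans hx
  simpa [dyadicCentre] using And.intro (h 0) (h 1)

lemma dyadicDisc_subset_scaledDyadicSq (m j l : ℤ) :
    dyadicDisc m j l ⊆ scaledDyadicSq 5 m j l := by
  intro x hx
  obtain ⟨h1, h2⟩ := abs_sub_le_of_mem_dyadicDisc hx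
  rw [abs_le] at h1 h2
  have hm : (0 : ℝ) < 2 ^ m := by positivity
  simp only [scaledDyadicSq, zpow_neg, ← div_eq_mul_inv, mem_ofPred_eq, mem_Icc, div_le_iff₀ hm,
    le_div_iff₀ hm]
  refine ⟨⟨?_, ?_⟩, ?_, ?_⟩ <;> linarith

lemma dyadicDisc_eq_closedBall (m j l : ℤ) :
    dyadicDisc m j l =
      closedBall (((2 : ℝ) ^ m)⁻¹ • dyadicCentre j l) (5 / 2 * ((2 : ℝ) ^ m)⁻¹) := by
  ext x
  have hm : (0 : ℝ) < 2 ^ m := by positivity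
  have h : (2 : ℝ) ^ m • x - dyadicCentre j l
      = (2 : ℝ) ^ m • (x - ((2 : ℝ) ^ m)⁻¹ • dyadicCentre j l) := by
    rw [smul_sub, smul_inv_smul₀ hm.ne']
  rw [dyadicDisc, mem_ofPred_eq, h, norm_smul, Real.norm_of_nonneg hm.le, mem_closedBall,
    dist_eq_norm, ← div_eq_mul_inv, le_div_iff₀ hm, mul_comm]

/-- At each point, the sum of the inverse sides of the distinct dyadic squares of side between
`2 ^ (-M)` and `1` whose discs contain the point is at most a constant times `2 ^ M`. -/
lemma sum_two_zpow_le_of_mem_dyadicDisc {ι : Type*} (s : Finset ι) (m j l : ι → ℤ)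
    (hinj : Set.InjOn (fun i ↦ (m i, j i, l i)) s) (M : ℤ) (x : EuclideanSpace ℝ (Fin 2))
    (hm : ∀ i ∈ s, 0 ≤ m i ∧ m i ≤ M) (hx : ∀ i ∈ s, x ∈ dyadicDisc (m i) (j i) (l i)) :
    ∑ i ∈ s, (2 : ℝ) ^ m i ≤ 72 * 2 ^ M := by
  classical
  have hmaps : ∀ i ∈ s, (m i).toNat ∈ Finset.range (M.toNat + 1) := fun i hi ↦ by
    have := hm i hi
    simp only [Finset.mem_range]
    omega
  have hfib (n : ℕ) : ∑ i ∈ s with (m i).toNat = n, (2 : ℝ) ^ m i ≤ 36 * 2 ^ n := by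
    have hterm : ∀ i ∈ s.filter (fun i ↦ (m i).toNat = n), (2 : ℝ) ^ m i = 2 ^ n := by
      intro i hi
      obtain ⟨hi, hin⟩ := Finset.mem_filter.1 hi
      rw [← hin, ← zpow_natCast, Int.toNat_of_nonneg (hm i hi).1]
    rw [Finset.sum_congr rfl hterm, Finset.sum_const, nsmul_eq_mul]
    refine mul_le_mul_of_nonneg_right ?_ (by positivity)
    let box (t : ℝ) : Finset ℤ := Finset.Icc (⌈t⌉ - 3) (⌈t⌉ + 2)
    have hbox {t : ℝ} {a : ℤ} (h : |t - (a + 1 / 2)| ≤ 5 / 2) : a ∈ box t := by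
      rw [abs_le] at h
      simp only [box, Finset.mem_Icc]
      have h1 : ⌈t⌉ ≤ a + 3 := Int.ceil_le.2 (by push_cast; linarith)
      have h2 : (a : ℝ) ≤ ((⌈t⌉ + 2 : ℤ) : ℝ) := by push_cast; linarith [Int.le_ceil t]
      exact ⟨by omega, by exact_mod_cast h2⟩
    have hcard : (s.filter (fun i ↦ (m i).toNat = n)).card
        ≤ (box (2 ^ n * x 0) ×ˢ box (2 ^ n * x 1)).card := by
      refine Finset.card_le_card_of_injOn (fun i ↦ (j i, l i)) (fun i hi ↦ ?_) ?_
      · have hi' := Finset.mem_filter.1 (Finset.mem_coe.1 hi)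
        have h := abs_sub_le_of_mem_dyadicDisc (hx i hi'.1)
        rw [hterm i (Finset.mem_coe.1 hi)] at h
        exact Finset.mem_coe.2 (Finset.mem_product.2 ⟨hbox h.1, hbox h.2⟩)
      · intro a ha b hb hab
        obtain ⟨ha, han⟩ := Finset.mem_filter.1 (Finset.mem_coe.1 ha)
        obtain ⟨hb, hbn⟩ := Finset.mem_filter.1 (Finset.mem_coe.1 hb)
        have hma := hm a ha
        have hmb := hm b hb
        have hmab : m a = m b := by omega
        exact hinj ha hb (Prod.ext hmab hab)
    have hboxcard (t : ℝ) : (box t).card = 6 := by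
      simp only [box, Int.card_Icc]
      omega
    rw [Finset.card_product, hboxcard, hboxcard] at hcard
    exact_mod_cast hcard
  rw [← Finset.sum_fiberwise_of_maps_to hmaps]
  rcases s.eq_empty_or_nonempty with rfl | ⟨i, hi⟩
  · simp only [Finset.filter_empty, Finset.sum_empty, Finset.sum_const_zero]
    positivity
  have hM : 0 ≤ M := (hm i hi).1.trans (hm i hi).2
  calc _ ≤ ∑ n ∈ Finset.range (M.toNat + 1), 36 * (2 : ℝ) ^ n :=
        Finset.sum_le_sum fun n _ ↦ hfib n
    _ = 36 * (2 ^ (M.toNat + 1) - 1) := by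
        rw [← Finset.mul_sum, geom_sum_eq (by norm_num)]
        norm_num
    _ ≤ 72 * 2 ^ M.toNat := by
        rw [pow_succ]
        linarith
    _ = 72 * 2 ^ M := by rw [← zpow_natCast, Int.toNat_of_nonneg hM]

lemma contDiff_dyadicBump {n : ℕ∞} (m j l : ℤ) : ContDiff ℝ n (dyadicBump m j l) :=
  unitBump.contDiff.comp ((contDiff_id.const_smul _).sub contDiff_const)

lemma dyadicBump_mem_Icc (m j l : ℤ) (x : EuclideanSpace ℝ (Fin 2)) :
    dyadicBump m j l x ∈ Icc (0 : ℝ) 1 :=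
  ⟨unitBump.nonneg, unitBump.le_one⟩

lemma tsupport_dyadicBump_subset (m j l : ℤ) :
    tsupport (dyadicBump m j l) ⊆ dyadicDisc m j l := by
  refine closure_minimal (fun x hx ↦ ?_)
    (by rw [dyadicDisc_eq_closedBall]; exact isClosed_closedBall)
  have h : (2 : ℝ) ^ m • x - dyadicCentre j l ∈ Function.support unitBump := hx
  rw [unitBump.support_eq, mem_ball_zero_iff] at h
  exact h.le

lemma iteratedFDeriv_dyadicBump (m j l : ℤ) (a : ℕ) (x : EuclideanSpace ℝ (Fin 2)) :
    iteratedFDeriv ℝ a (dyadicBump m j l) x =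
      ((2 : ℝ) ^ m) ^ a • iteratedFDeriv ℝ a unitBump ((2 : ℝ) ^ m • x - dyadicCentre j l) := by
  have h : ContDiff ℝ a fun z ↦ unitBump (z - dyadicCentre j l) :=
    unitBump.contDiff.comp (contDiff_id.sub contDiff_const)
  have := congrFun (iteratedFDeriv_comp_const_smul ((2 : ℝ) ^ m) h) x
  rw [iteratedFDeriv_comp_sub] at this
  exact this

/-- The derivatives of `unitBump` up to a given order are uniformly bounded. -/
lemma exists_norm_iteratedFDeriv_unitBump_le (k : ℕ) :
    ∃ C : ℝ, 1 ≤ C ∧ ∀ a ≤ k, ∀ x, ‖iteratedFDeriv ℝ a unitBump x‖ ≤ C := by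
  have hbdd (a : ℕ) : ∃ C, ∀ x, ‖iteratedFDeriv ℝ a unitBump x‖ ≤ C :=
    (unitBump.hasCompactSupport.iteratedFDeriv a).exists_bound_of_continuous
      ((unitBump.contDiff (n := ⊤)).continuous_iteratedFDeriv (by exact_mod_cast le_top))
  choose C hC using hbdd
  have hC0 (a : ℕ) : 0 ≤ C a := (norm_nonneg _).trans (hC a 0)
  refine ⟨1 + ∑ a ∈ Finset.range (k + 1), C a,
    le_add_of_nonneg_right (Finset.sum_nonneg fun a _ ↦ hC0 a), fun a ha x ↦ (hC a x).trans ?_⟩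
  have := Finset.single_le_sum (fun a _ ↦ hC0 a) (Finset.mem_range.2 (Nat.lt_succ_of_le ha))
  linarith

open Classical in
/-- The common weight dominating the derivatives of `dyadicBump m j l` and of its complement. -/
def dyadicWeight (C : ℝ) (m j l : ℤ) (x : EuclideanSpace ℝ (Fin 2)) : ℝ :=
  if x ∈ dyadicDisc m j l then C * 2 ^ m else 0

lemma norm_iteratedFDeriv_dyadicBump_le {k : ℕ} {C : ℝ} (hC1 : 1 ≤ C)
    (hC : ∀ a ≤ k, ∀ x, ‖iteratedFDeriv ℝ a unitBump x‖ ≤ C) (m j l : ℤ) {a : ℕ} (ha : a ≤ k)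
    (x : EuclideanSpace ℝ (Fin 2)) :
    ‖iteratedFDeriv ℝ a (dyadicBump m j l) x‖ ≤ dyadicWeight C m j l x ^ a := by
  rcases Nat.eq_zero_or_pos a with rfl | ha0
  · have := dyadicBump_mem_Icc m j l x
    rw [norm_iteratedFDeriv_zero, pow_zero, Real.norm_of_nonneg this.1]
    exact this.2
  unfold dyadicWeight
  split_ifs with hx
  · rw [iteratedFDeriv_dyadicBump, norm_smul, Real.norm_of_nonneg (by positivity), mul_pow,
      mul_comm]
    exact mul_le_mul_of_nonneg_right ((hC a ha _).trans (le_self_pow₀ hC1 ha0.ne'))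
      (by positivity)
  · rw [zero_pow ha0.ne', norm_le_zero_iff]
    by_contra h
    exact hx (tsupport_dyadicBump_subset m j l (support_iteratedFDeriv_subset a h))

lemma norm_iteratedFDeriv_one_sub_dyadicBump_le {k : ℕ} {C : ℝ} (hC1 : 1 ≤ C)
    (hC : ∀ a ≤ k, ∀ x, ‖iteratedFDeriv ℝ a unitBump x‖ ≤ C) (m j l : ℤ) {a : ℕ} (ha : a ≤ k)
    (x : EuclideanSpace ℝ (Fin 2)) :
    ‖iteratedFDeriv ℝ a (fun y ↦ 1 - dyadicBump m j l y) x‖ ≤ dyadicWeight C m j l x ^ a := by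
  rcases Nat.eq_zero_or_pos a with rfl | ha0
  · have := dyadicBump_mem_Icc m j l x
    rw [norm_iteratedFDeriv_zero, pow_zero, Real.norm_of_nonneg (by linarith [this.2])]
    linarith [this.1]
  · rw [fun_iteratedFDeriv_sub_apply contDiff_const.contDiffAt
      (contDiff_dyadicBump m j l).contDiffAt, iteratedFDeriv_const_of_ne ha0.ne', Pi.zero_apply,
      zero_sub, norm_neg]
    exact norm_iteratedFDeriv_dyadicBump_le hC1 hC m j l ha x

lemma Nk_zero_right {E F : Type*} [NormedAddCommGroup E] [NormedSpace ℝ E]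
    [NormedAddCommGroup F] [NormedSpace ℝ F] (k : ℕ) : Nk k (0 : E → F) = 0 := by
  simp [Nk]

/-- The quantity `Nk` is controlled by bounds on the support and on the derivative. -/
lemma Nk_le_of_tsupport_subset_closedBall {E F : Type*} [NormedAddCommGroup E] [NormedSpace ℝ E]
    [NormedAddCommGroup F] [NormedSpace ℝ F] {k : ℕ} {φ : E → F} {c : E} {r B : ℝ} (hr : 0 ≤ r)
    (hφ : tsupport φ ⊆ closedBall c r) (hB : ∀ x, ‖iteratedFDeriv ℝ k φ x‖ ≤ B) :
    Nk k φ ≤ (2 * r) ^ k * B := by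
  have hdiam : diam (tsupport φ) ≤ 2 * r :=
    (diam_mono hφ isBounded_closedBall).trans (diam_closedBall hr)
  exact mul_le_mul (pow_le_pow_left₀ diam_nonneg hdiam k) (ciSup_le hB)
    (Real.iSup_nonneg fun _ ↦ norm_nonneg _) (by positivity)

/-- The partition of unity subordinate to finitely many distinct dyadic squares, enumerated in an
order of decreasing side. -/
lemma exists_dyadic_partition (k : ℕ) {C : ℝ} (hC1 : 1 ≤ C)
    (hC : ∀ a ≤ k, ∀ x, ‖iteratedFDeriv ℝ a unitBump x‖ ≤ C)
    {ι : Type*} [LinearOrder ι] (s : Finset ι) (m j l : ι → ℤ)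
    (hinj : Function.Injective fun i ↦ (m i, j i, l i)) (hmono : Monotone m)
    (hm : ∀ i ∈ s, 0 ≤ m i) :
    ∃ φ : ι → EuclideanSpace ℝ (Fin 2) → ℝ,
      (∀ i, ContDiff ℝ (⊤ : ℕ∞) (φ i)) ∧
      (∀ i, tsupport (φ i) ⊆ dyadicDisc (m i) (j i) (l i)) ∧
      (∀ x, ∑ i ∈ s, φ i x = 1 - ∏ i ∈ s, (1 - dyadicBump (m i) (j i) (l i) x)) ∧
      ∀ i ∈ s, Nk k (φ i) ≤ (360 * C) ^ k := by
  have hC0 : 0 ≤ C := zero_le_one.trans hC1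
  set ψ : ι → EuclideanSpace ℝ (Fin 2) → ℝ := fun i ↦ dyadicBump (m i) (j i) (l i) with hψ
  have hψs (i) : ContDiff ℝ (⊤ : ℕ∞) (ψ i) := contDiff_dyadicBump _ _ _
  have htsupp (i : ι) : tsupport (fun x ↦ ψ i x * ∏ p ∈ s with p < i, (1 - ψ p x))
      ⊆ dyadicDisc (m i) (j i) (l i) :=
    (tsupport_mul_subset_left (f := ψ i)).trans (tsupport_dyadicBump_subset _ _ _)
  refine ⟨fun i x ↦ ψ i x * ∏ p ∈ s with p < i, (1 - ψ p x), fun i ↦ ?_, htsupp, fun x ↦ ?_,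
    fun i hi ↦ ?_⟩
  · exact (hψs i).mul (contDiff_prod fun p _ ↦ contDiff_const.sub (hψs p))
  · rw [Finset.prod_one_sub_ordered, sub_sub_cancel]
  have hpow : (0 : ℝ) < 2 ^ m i := by positivity
  have hderiv (x) : ‖iteratedFDeriv ℝ k (fun x ↦ ψ i x * ∏ p ∈ s with p < i, (1 - ψ p x)) x‖
      ≤ (C * (72 * 2 ^ m i)) ^ k := by
    let f : ι → EuclideanSpace ℝ (Fin 2) → ℝ := fun p ↦ if p = i then ψ i else fun y ↦ 1 - ψ p y
    set u : Finset ι := insert i (s.filter (· < i)) with hu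
    have hprod : (fun x ↦ ψ i x * ∏ p ∈ s with p < i, (1 - ψ p x))
        = fun x ↦ ∏ p ∈ u, f p x := by
      funext y
      rw [hu, Finset.prod_insert (by simp)]
      congr 1
      · simp [f]
      · refine Finset.prod_congr rfl fun p hp ↦ ?_
        simp [f, (Finset.mem_filter.1 hp).2.ne]
    have hfs (p) (_ : p ∈ u) : ContDiff ℝ k (f p) := by
      have hle : (k : WithTop ℕ∞) ≤ ((⊤ : ℕ∞) : WithTop ℕ∞) := by exact_mod_cast le_top
      by_cases h : p = i
      · simpa [f, h] using (hψs i).of_le hle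
      · simpa [f, h] using contDiff_const.sub ((hψs p).of_le hle)
    have hfw (p) (_ : p ∈ u) (a) (ha : a ≤ k) :
        ‖iteratedFDeriv ℝ a (f p) x‖ ≤ dyadicWeight C (m p) (j p) (l p) x ^ a := by
      by_cases h : p = i
      · simpa [f, h] using norm_iteratedFDeriv_dyadicBump_le hC1 hC (m i) (j i) (l i) ha x
      · simpa [f, h] using norm_iteratedFDeriv_one_sub_dyadicBump_le hC1 hC (m p) (j p) (l p) ha x
    have hule (p) (hp : p ∈ u) : 0 ≤ m p ∧ m p ≤ m i := by
      rcases Finset.mem_insert.1 hp with rfl | hp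
      · exact ⟨hm _ hi, le_rfl⟩
      · obtain ⟨hps, hpi⟩ := Finset.mem_filter.1 hp
        exact ⟨hm p hps, hmono hpi.le⟩
    rw [hprod]
    refine (norm_iteratedFDeriv_prod_le_sum_pow hfs hfw).trans ?_
    classical
    simp only [dyadicWeight]
    rw [← Finset.sum_filter, ← Finset.mul_sum]
    refine pow_le_pow_left₀ (by positivity) (mul_le_mul_of_nonneg_left ?_ hC0) k
    exact sum_two_zpow_le_of_mem_dyadicDisc _ m j l hinj.injOn (m i) x
      (fun p hp ↦ hule p (Finset.mem_filter.1 hp).1) fun p hp ↦ (Finset.mem_filter.1 hp).2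
  have hball := htsupp i
  rw [dyadicDisc_eq_closedBall] at hball
  refine (Nk_le_of_tsupport_subset_closedBall (by positivity) hball hderiv).trans_eq ?_
  rw [← mul_pow]
  congr 1
  field_simp
  ring

/-- partition-of-identity lemma.  For each `k` there is a constant `K`
such that whenever a compact `E ⊆ ℝ²` is covered by countably many closed dyadic squares
`Sₙ` of side at most `1`, there are test functions `φₙ`, all but finitely many zero,
summing to `1` on a neighbourhood of `E`, with `N_k(φₙ) ≤ K` and `supp φₙ ⊆ 5·Sₙ`. -/
theorem statement3 (k : ℕ) :
    ∃ K : ℝ, 0 < K ∧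
      ∀ E : Set (EuclideanSpace ℝ (Fin 2)), IsCompact E →
      ∀ sq : ℕ → ℤ × ℤ × ℤ, (∀ n, 0 ≤ (sq n).1) →
      E ⊆ (⋃ n, dyadicSq (sq n).1 (sq n).2.1 (sq n).2.2) →
      ∃ φ : ℕ → EuclideanSpace ℝ (Fin 2) → ℝ,
        (∀ n, ContDiff ℝ (⊤ : ℕ∞) (φ n) ∧ HasCompactSupport (φ n)) ∧
        {n | φ n ≠ 0}.Finite ∧
        (∃ V : Set (EuclideanSpace ℝ (Fin 2)), IsOpen V ∧ E ⊆ V ∧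
          ∀ x ∈ V, ∑' n, φ n x = 1) ∧
        (∀ n, Nk k (φ n) ≤ K) ∧
        (∀ n, tsupport (φ n) ⊆ scaledDyadicSq 5 (sq n).1 (sq n).2.1 (sq n).2.2) := by
  classical
  obtain ⟨C, hC1, hC⟩ := exists_norm_iteratedFDeriv_unitBump_le k
  have hC0 : 0 < C := zero_lt_one.trans_le hC1
  refine ⟨(360 * C) ^ k, by positivity, fun E hE sq hsq hcov ↦ ?_⟩
  let U (n : ℕ) : Set (EuclideanSpace ℝ (Fin 2)) :=
    {x | ‖(2 : ℝ) ^ (sq n).1 • x - dyadicCentre (sq n).2.1 (sq n).2.2‖ < 1}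
  have hU (n) : IsOpen (U n) := isOpen_lt (by fun_prop) continuous_const
  obtain ⟨T, hT⟩ := hE.elim_finite_subcover U hU fun x hx ↦ by
    obtain ⟨n, hn⟩ := mem_iUnion.1 (hcov hx)
    exact mem_iUnion.2 ⟨n, norm_smul_sub_dyadicCentre_lt hn⟩
  let e (n : ℕ) : ℤ ×ₗ (ℤ ×ₗ ℤ) := toLex ((sq n).1, toLex ((sq n).2.1, (sq n).2.2))
  obtain ⟨T', hT'T, hinjT, himage⟩ := Finset.exists_subset_injOn_image_eq_of_surjOn
    (f := e) (T : Set ℕ) (T.image e) (by rw [Finset.coe_image]; exact surjOn_image e T)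
  obtain ⟨φ, hφs, hφt, hφsum, hφN⟩ := exists_dyadic_partition k hC1 hC (T.image e)
    (fun p ↦ (ofLex p).1) (fun p ↦ (ofLex (ofLex p).2).1) (fun p ↦ (ofLex (ofLex p).2).2)
    (fun p q h ↦ h) Prod.Lex.monotone_fst_ofLex
    (fun p hp ↦ by
      obtain ⟨n, -, rfl⟩ := Finset.mem_image.1 hp
      exact hsq n)
  have hdisc (n) : tsupport (if n ∈ T' then φ (e n) else 0)
      ⊆ dyadicDisc (sq n).1 (sq n).2.1 (sq n).2.2 := by
    split_ifs
    · exact hφt (e n)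
    · simp [tsupport]
  refine ⟨fun n ↦ if n ∈ T' then φ (e n) else 0, fun n ↦ ⟨?_, ?_⟩, ?_,
    ⟨⋃ n ∈ T, U n, isOpen_biUnion fun n _ ↦ hU n, hT, fun x hx ↦ ?_⟩, fun n ↦ ?_,
    fun n ↦ (hdisc n).trans (dyadicDisc_subset_scaledDyadicSq _ _ _)⟩
  · dsimp only
    split_ifs
    · exact hφs (e n)
    · exact contDiff_const
  · refine HasCompactSupport.of_support_subset_isCompact ?_ (subset_closure.trans (hdisc n))
    rw [dyadicDisc_eq_closedBall]
    exact isCompact_closedBall _ _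
  · refine T'.finite_toSet.subset fun n hn ↦ ?_
    by_contra h
    exact hn (if_neg h)
  · obtain ⟨n, hnT, hn⟩ := mem_iUnion₂.1 hx
    have hsum : ∑ n ∈ T', (if n ∈ T' then φ (e n) else 0) x = ∑ p ∈ T.image e, φ p x := by
      rw [← himage, Finset.sum_image hinjT]
      exact Finset.sum_congr rfl fun n hn ↦ by rw [if_pos hn]
    rw [tsum_eq_sum (s := T') fun n hn ↦ by simp [hn], hsum, hφsum,
      Finset.prod_eq_zero (Finset.mem_image_of_mem e hnT), sub_zero]
    rw [sub_eq_zero, eq_comm]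
    exact unitBump.one_of_mem_closedBall (mem_closedBall_zero_iff.2 (le_of_lt hn))
  · dsimp only
    split_ifs with h
    · exact hφN _ (Finset.mem_image_of_mem e (hT'T h))
    · rw [Nk_zero_right]
      positivity


end
end

section
/- Let 0 < β < 2. There exists a constant K > 0, depending only on β, such that for every positive Borel measure μ on ℂ satisfying the growth condition μ(B̄(a,r)) ≤ r^β for all a ∈ ℂ and all r > 0, and for every z ∈ ℂ and t > 0, one has ∫_ℂ t/(π(t² + |z−ζ|²)^{3/2}) dμ(ζ) ≤ K · t^{β−2}. -/
open MeasureTheory Metric ENNReal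

noncomputable section

/-- Dyadic pointwise bound for the Poisson kernel: some dyadic multiple `2 ^ n * t` of the height
bounds `d`, and the kernel is controlled by the corresponding power of `2`. -/
lemma exists_dyadic_poisson_bound {t d : ℝ} (ht : 0 < t) :
    ∃ n : ℕ, d ≤ 2 ^ n * t ∧
      t / (Real.pi * (t ^ 2 + d ^ 2) ^ ((3:ℝ) / 2)) ≤ 8 / Real.pi * (t * (2 ^ n * t)⁻¹ ^ 3) := by
  classical
  have hex : ∃ n : ℕ, d ≤ 2 ^ n * t := by
    obtain ⟨n, hn⟩ := pow_unbounded_of_one_lt (d / t) (one_lt_two : (1:ℝ) < 2)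
    exact ⟨n, ((div_lt_iff₀ ht).1 hn).le⟩
  refine ⟨Nat.find hex, Nat.find_spec hex, ?_⟩
  set n := Nat.find hex with hn
  have hpi := Real.pi_pos
  have hlow : (2 ^ n * t / 2) ^ 2 ≤ t ^ 2 + d ^ 2 := by
    rcases Nat.eq_zero_or_pos n with h0 | hpos
    · rw [h0]
      nlinarith [sq_nonneg d, sq_nonneg t]
    · have hlt : ¬ d ≤ 2 ^ (n - 1) * t := Nat.find_min hex (by omega)
      have heq : (2:ℝ) ^ n * t / 2 = 2 ^ (n - 1) * t := by
        obtain ⟨m, hm⟩ : ∃ m, n = m + 1 := ⟨n - 1, by omega⟩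
        rw [hm, Nat.add_sub_cancel, pow_succ]
        ring
      rw [heq]
      have : (2 ^ (n - 1) * t) ^ 2 ≤ d ^ 2 := pow_le_pow_left₀ (by positivity) (not_le.1 hlt).le 2
      nlinarith [sq_nonneg t]
  have hcube : (2 ^ n * t / 2) ^ 3 ≤ (t ^ 2 + d ^ 2) ^ ((3:ℝ) / 2) := by
    have h := Real.rpow_le_rpow (by positivity) hlow (by norm_num : (0:ℝ) ≤ 3 / 2)
    rwa [← Real.rpow_natCast_mul (by positivity),
      show ((2:ℕ):ℝ) * (3 / 2) = ((3:ℕ):ℝ) by norm_num, Real.rpow_natCast] at h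
  calc t / (Real.pi * (t ^ 2 + d ^ 2) ^ ((3:ℝ) / 2))
      ≤ t / (Real.pi * (2 ^ n * t / 2) ^ 3) := by gcongr
    _ = 8 / Real.pi * (t * (2 ^ n * t)⁻¹ ^ 3) := by field_simp; ring

/-- For `0 < β < 2` there is a constant `K > 0`, depending only on `β`,
such that for every positive Borel measure `μ` on `ℂ` with growth `μ(B̄(a,r)) ≤ r^β`
for all `a ∈ ℂ`, `r > 0`, and all `z ∈ ℂ`, `t > 0`, the Poisson transform satisfies
`∫ t/(π(t² + |z-ζ|²)^{3/2}) dμ(ζ) ≤ K · t^{β-2}`. -/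
theorem statement6 (β : ℝ) (hβ0 : 0 < β) (hβ2 : β < 2) :
    ∃ K : ℝ, 0 < K ∧
      ∀ μ : Measure ℂ,
        (∀ (a : ℂ) (r : ℝ), 0 < r → μ (Metric.closedBall a r) ≤ ENNReal.ofReal (r ^ β)) →
        ∀ (z : ℂ) (t : ℝ), 0 < t →
          ∫⁻ ζ, ENNReal.ofReal
              (t / (Real.pi * (t ^ 2 + ‖z - ζ‖ ^ 2) ^ ((3:ℝ) / 2))) ∂μ
            ≤ ENNReal.ofReal (K * t ^ (β - 2)) := by
  set q : ℝ := 2 ^ (β - 3) with hq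
  have hq0 : 0 < q := by positivity
  have hq1 : q < 1 := Real.rpow_lt_one_of_one_lt_of_neg one_lt_two (by linarith)
  have hpi := Real.pi_pos
  have h1q : 0 < 1 - q := by linarith
  refine ⟨8 / Real.pi * (1 - q)⁻¹, by positivity, fun μ hμ z t ht => ?_⟩
  set c : ℕ → ℝ := fun n => 8 / Real.pi * (t * (2 ^ n * t)⁻¹ ^ 3) with hc
  have hc0 : ∀ n, 0 ≤ c n := fun n => by positivity
  have hterm : ∀ n, c n * (2 ^ n * t) ^ β = 8 / Real.pi * t ^ (β - 2) * q ^ n := by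
    intro n
    have hs : (0:ℝ) < 2 ^ n * t := by positivity
    have h1 : (2 ^ n * t) ^ β = (2 ^ n * t) ^ (β - 3) * (2 ^ n * t) ^ 3 := by
      rw [← Real.rpow_natCast (2 ^ n * t) 3, ← Real.rpow_add hs]
      norm_num
    have h2 : (2 ^ n * t) ^ (β - 3) = q ^ n * t ^ (β - 3) := by
      rw [Real.mul_rpow (by positivity) ht.le, hq, Real.rpow_pow_comm (by norm_num)]
    have h3 : t ^ (β - 2) = t ^ (β - 3) * t := by
      rw [← Real.rpow_add_one ht.ne']
      ring_nf
    simp only [hc]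
    rw [h1, h2, h3]
    field_simp
  calc ∫⁻ ζ, ENNReal.ofReal (t / (Real.pi * (t ^ 2 + ‖z - ζ‖ ^ 2) ^ ((3:ℝ) / 2))) ∂μ
      ≤ ∫⁻ ζ, ∑' n : ℕ,
          (closedBall z (2 ^ n * t)).indicator (fun _ => ENNReal.ofReal (c n)) ζ ∂μ := by
        refine lintegral_mono fun ζ => ?_
        obtain ⟨n, hn, hle⟩ := exists_dyadic_poisson_bound (d := ‖z - ζ‖) ht
        refine le_trans ?_ (ENNReal.le_tsum n)
        rw [Set.indicator_of_mem (by rwa [mem_closedBall', dist_eq_norm])]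
        exact ENNReal.ofReal_le_ofReal hle
    _ = ∑' n : ℕ, ENNReal.ofReal (c n) * μ (closedBall z (2 ^ n * t)) := by
        rw [lintegral_tsum fun n =>
          (measurable_const.indicator measurableSet_closedBall).aemeasurable]
        simp_rw [lintegral_indicator_const measurableSet_closedBall]
    _ ≤ ∑' n : ℕ, ENNReal.ofReal (8 / Real.pi * t ^ (β - 2) * q ^ n) := by
        refine ENNReal.tsum_le_tsum fun n => ?_
        rw [← hterm n, ENNReal.ofReal_mul (hc0 n)]
        gcongr
        exact hμ z _ (by positivity)
    _ = ENNReal.ofReal (8 / Real.pi * (1 - q)⁻¹ * t ^ (β - 2)) := by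
        rw [← ENNReal.ofReal_tsum_of_nonneg (fun n => by positivity)
          ((summable_geometric_of_lt_one hq0.le hq1).mul_left _), tsum_mul_left,
          tsum_geometric_of_lt_one hq0.le hq1]
        ring_nf

end
end

section
/- Let 0 < β < 1. There exists a constant K > 0, depending only on β, such that the following holds. Suppose (ν_n)_{n≥1} is a sequence of positive Borel measures on ℂ such that for every n: supp(ν_n) ⊆ {z ∈ ℂ : 2^{−n−1} ≤ |z| ≤ 2^{−n}}, ν_n(B̄(a,r)) ≤ r^β for all a ∈ ℂ and r > 0, and ν_n(ℂ) ≤ 2^{−n}. Then for every z ∈ ℂ and every t > 0, Σ_{n=1}^∞ ∫_ℂ t/(π(t² + |z−ζ|²)^{3/2}) dν_n(ζ) ≤ K · t^{β−2}. -/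
open MeasureTheory Metric ENNReal

noncomputable section

/-- If `t² + d² ≥ R²` then the Poisson kernel at height `t` and distance `d` is at most `t / R³`. -/
lemma poisson_kernel_le {t d R : ℝ} (ht : 0 < t) (hR : 0 < R) (h : R ^ 2 ≤ t ^ 2 + d ^ 2) :
    t / (Real.pi * (t ^ 2 + d ^ 2) ^ ((3:ℝ) / 2)) ≤ t / R ^ 3 := by
  have hpow : R ^ 3 ≤ (t ^ 2 + d ^ 2) ^ ((3:ℝ) / 2) := by
    calc R ^ 3 = (R ^ 2) ^ ((3:ℝ) / 2) := by
          rw [← Real.rpow_natCast R 2, ← Real.rpow_mul hR.le, ← Real.rpow_natCast R 3]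
          norm_num
      _ ≤ _ := Real.rpow_le_rpow (by positivity) h (by norm_num)
  have hpi : (1:ℝ) ≤ Real.pi := by linarith [Real.pi_gt_three]
  have hR3 : 0 < R ^ 3 := by positivity
  gcongr
  nlinarith

/-- Dyadic decomposition of the Poisson kernel: it is dominated by a sum of multiples of
indicators of the discs of radius `2^k t`. -/
lemma poisson_kernel_le_tsum (z ζ : ℂ) {t : ℝ} (ht : 0 < t) :
    ENNReal.ofReal (t / (Real.pi * (t ^ 2 + ‖z - ζ‖ ^ 2) ^ ((3:ℝ) / 2))) ≤
      ∑' k : ℕ, (closedBall z (2 ^ k * t)).indicator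
        (fun _ => ENNReal.ofReal (8 / t ^ 2 * (1 / 8) ^ k)) ζ := by
  have hex : ∃ k : ℕ, ‖z - ζ‖ ≤ 2 ^ k * t := by
    obtain ⟨k, hk⟩ := pow_unbounded_of_one_lt (‖z - ζ‖ / t) one_lt_two
    exact ⟨k, ((div_lt_iff₀ ht).1 hk).le⟩
  classical
  obtain ⟨k, hk, hmin⟩ : ∃ k : ℕ, ‖z - ζ‖ ≤ 2 ^ k * t ∧
      (2 ^ k * t / 2) ^ 2 ≤ t ^ 2 + ‖z - ζ‖ ^ 2 := by
    refine ⟨Nat.find hex, Nat.find_spec hex, ?_⟩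
    rcases hn : Nat.find hex with _ | m
    · nlinarith [sq_nonneg ‖z - ζ‖, sq_nonneg t]
    · have hm := Nat.find_min hex (m := m) (by omega)
      rw [not_le] at hm
      have heq : (2:ℝ) ^ (m + 1) * t / 2 = 2 ^ m * t := by ring
      rw [heq]
      have hsq : (2 ^ m * t) ^ 2 ≤ ‖z - ζ‖ ^ 2 := by gcongr
      nlinarith [sq_nonneg t]
  refine le_trans ?_ (ENNReal.le_tsum k)
  have hmem : ζ ∈ closedBall z (2 ^ k * t) := by
    rwa [mem_closedBall, dist_comm, dist_eq_norm]
  rw [Set.indicator_of_mem hmem]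
  refine ENNReal.ofReal_le_ofReal
    ((poisson_kernel_le ht (by positivity) hmin).trans_eq ?_)
  have h8 : (8:ℝ) ^ k = (2 ^ k) ^ 3 := by
    rw [← pow_mul, mul_comm, pow_mul]
    norm_num
  rw [one_div, inv_pow, h8]
  field_simp
  norm_num

/-- The Poisson transform of a measure whose disc masses are `O(r^β)`, `β ≤ 1`, is
`O(t^(β-2))`. -/
lemma lintegral_poisson_le {β C : ℝ} (hβ : β ≤ 1) (hC : 0 ≤ C) {μ : Measure ℂ} {z : ℂ}
    (hμ : ∀ r : ℝ, 0 < r → μ (closedBall z r) ≤ ENNReal.ofReal (C * r ^ β))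
    {t : ℝ} (ht : 0 < t) :
    ∫⁻ ζ, ENNReal.ofReal (t / (Real.pi * (t ^ 2 + ‖z - ζ‖ ^ 2) ^ ((3:ℝ) / 2))) ∂μ ≤
      ENNReal.ofReal (32 / 3 * C * t ^ (β - 2)) := by
  have hterm : ∀ k : ℕ, ENNReal.ofReal (8 / t ^ 2 * (1 / 8) ^ k) * μ (closedBall z (2 ^ k * t)) ≤
      ENNReal.ofReal (8 * C * t ^ (β - 2) * (1 / 4) ^ k) := by
    intro k
    refine (mul_le_mul_right (hμ _ (by positivity)) _).trans ?_
    rw [← ENNReal.ofReal_mul (by positivity)]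
    refine ENNReal.ofReal_le_ofReal ?_
    have h2 : ((2:ℝ) ^ k) ^ β ≤ 2 ^ k := by
      simpa using Real.rpow_le_rpow_of_exponent_le (one_le_pow₀ (one_le_two (α := ℝ)) (n := k)) hβ
    have hts : t ^ (β - 2) = t ^ β / t ^ 2 := by
      rw [Real.rpow_sub ht]
      norm_num
    have h48 : ((1:ℝ) / 4) ^ k = (1 / 8) ^ k * 2 ^ k := by
      rw [← mul_pow]
      norm_num
    rw [Real.mul_rpow (by positivity) ht.le, hts, h48]
    calc 8 / t ^ 2 * (1 / 8) ^ k * (C * ((2 ^ k) ^ β * t ^ β))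
        ≤ 8 / t ^ 2 * (1 / 8) ^ k * (C * (2 ^ k * t ^ β)) := by gcongr
      _ = _ := by ring
  have hgeom : HasSum (fun k : ℕ => ((1:ℝ) / 4) ^ k) (4 / 3) := by
    convert hasSum_geometric_of_lt_one (r := (1:ℝ) / 4) (by norm_num) (by norm_num) using 1
    norm_num
  have hsum := hgeom.mul_left (8 * C * t ^ (β - 2))
  calc ∫⁻ ζ, ENNReal.ofReal (t / (Real.pi * (t ^ 2 + ‖z - ζ‖ ^ 2) ^ ((3:ℝ) / 2))) ∂μ
      ≤ ∫⁻ ζ, ∑' k : ℕ, (closedBall z (2 ^ k * t)).indicator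
          (fun _ => ENNReal.ofReal (8 / t ^ 2 * (1 / 8) ^ k)) ζ ∂μ :=
        lintegral_mono fun ζ => poisson_kernel_le_tsum z ζ ht
    _ = ∑' k : ℕ, ENNReal.ofReal (8 / t ^ 2 * (1 / 8) ^ k) * μ (closedBall z (2 ^ k * t)) := by
        rw [lintegral_tsum fun k =>
          (measurable_const.indicator measurableSet_closedBall).aemeasurable]
        simp_rw [lintegral_indicator_const measurableSet_closedBall]
    _ ≤ ∑' k : ℕ, ENNReal.ofReal (8 * C * t ^ (β - 2) * (1 / 4) ^ k) :=
        ENNReal.tsum_le_tsum hterm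
    _ = ENNReal.ofReal (32 / 3 * C * t ^ (β - 2)) := by
        rw [← ENNReal.ofReal_tsum_of_nonneg (fun k => by positivity) hsum.summable, hsum.tsum_eq]
        ring_nf

/-- A geometric series started at index `m` sums to `2`. -/
lemma tsum_ite_geometric_two (m : ℕ) :
    ∑' n : ℕ, (if m ≤ n then ENNReal.ofReal ((1 / 2) ^ (n - m)) else 0) = 2 := by
  rw [← Summable.sum_add_tsum_nat_add' (k := m) ENNReal.summable,
    Finset.sum_eq_zero fun n hn => if_neg (by simpa using hn)]
  simp only [le_add_iff_nonneg_left, zero_le, if_true, Nat.add_sub_cancel, zero_add]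
  rw [← ENNReal.ofReal_tsum_of_nonneg (fun k => by positivity) summable_geometric_two,
    tsum_geometric_two]
  norm_num

/-- If `ν n` has the growth `ν n (B̄(a,r)) ≤ r^β`, lives on the annulus
`2^(-n-2) ≤ |ζ| ≤ 2^(-n-1)` and has mass at most `2^(-n-1)`, then the sum of the `ν n` has the
same growth up to a constant. -/
lemma tsum_measure_closedBall_le {β : ℝ} (hβ0 : 0 ≤ β) (hβ1 : β ≤ 1) {ν : ℕ → Measure ℂ}
    (hsupp : ∀ n : ℕ, ν n {ζ : ℂ | ¬((1 / 2 : ℝ) ^ (n + 2) ≤ ‖ζ‖ ∧ ‖ζ‖ ≤ (1 / 2) ^ (n + 1))} = 0)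
    (hball : ∀ (n : ℕ) (a : ℂ) (r : ℝ), 0 < r → ν n (closedBall a r) ≤ ENNReal.ofReal (r ^ β))
    (hmass : ∀ n : ℕ, ν n Set.univ ≤ ENNReal.ofReal ((1 / 2) ^ (n + 1)))
    (a : ℂ) {r : ℝ} (hr : 0 < r) :
    ∑' n : ℕ, ν n (closedBall a r) ≤ ENNReal.ofReal (16 * r ^ β) := by
  set S : Set ℕ := {n | (1 / 2 : ℝ) ^ (n + 2) ≤ 2 * r} with hS
  set T : Set ℕ := {n | (1 / 2 : ℝ) ^ (n + 2) ≤ 2 * ‖a‖ ∧ ‖a‖ ≤ 5 / 2 * (1 / 2) ^ (n + 2)}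
  set w : ℕ → ℕ → ℝ≥0∞ := fun m n => if m ≤ n then ENNReal.ofReal ((1 / 2) ^ (n - m)) else 0
  have hrβ : 0 < r ^ β := Real.rpow_pos_of_pos hr β
  have hterm : ∀ n, ν n (closedBall a r) ≤
      ENNReal.ofReal (4 * r ^ β) * (w (sInf S) n + w (sInf T) n) := by
    intro n
    by_cases hnS : n ∈ S
    · have hle : sInf S ≤ n := Nat.sInf_le hnS
      have hfirst : (1 / 2 : ℝ) ^ (sInf S + 2) ≤ 2 * r := Nat.sInf_mem ⟨n, hnS⟩
      have hone : (1 / 2 : ℝ) ^ (sInf S + 1) ≤ 1 := pow_le_one₀ (by norm_num) (by norm_num)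
      have hfour : (1 / 2 : ℝ) ^ (sInf S + 1) ≤ 4 * r ^ β := by
        rcases le_total r 1 with h1 | h1
        · have : r ≤ r ^ β := by
            simpa using Real.rpow_le_rpow_of_exponent_ge hr h1 hβ1
          have h2 : (1 / 2 : ℝ) ^ (sInf S + 2) = (1 / 2) ^ (sInf S + 1) / 2 := by ring
          linarith
        · have := Real.one_le_rpow h1 hβ0
          linarith
      calc ν n (closedBall a r) ≤ ENNReal.ofReal ((1 / 2) ^ (n + 1)) :=
            (measure_mono (Set.subset_univ _)).trans (hmass n)
        _ ≤ ENNReal.ofReal (4 * r ^ β) * w (sInf S) n := by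
            simp only [w, if_pos hle]
            rw [← ENNReal.ofReal_mul (by positivity)]
            refine ENNReal.ofReal_le_ofReal ?_
            calc (1 / 2 : ℝ) ^ (n + 1) = (1 / 2) ^ (sInf S + 1) * (1 / 2) ^ (n - sInf S) := by
                  rw [← pow_add]
                  congr 1
                  omega
              _ ≤ _ := by gcongr
        _ ≤ _ := by
            gcongr
            exact le_self_add
    by_cases hnT : n ∈ T
    · have hle : sInf T ≤ n := Nat.sInf_le hnT
      have hfirst : sInf T ∈ T := Nat.sInf_mem ⟨n, hnT⟩
      have hdist : n - sInf T ≤ 2 := by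
        by_contra! h
        have h3 : (1 / 2 : ℝ) ^ (n + 2) ≤ (1 / 2) ^ (sInf T + 2) * (1 / 2) ^ 3 := by
          rw [← pow_add]
          exact pow_le_pow_of_le_one (by norm_num) (by norm_num) (by omega)
        have hpos : (0:ℝ) < (1 / 2) ^ (sInf T + 2) := by positivity
        linarith [hfirst.1, hnT.2]
      have hquarter : (1 / 4 : ℝ) ≤ (1 / 2) ^ (n - sInf T) :=
        le_trans (by norm_num) (pow_le_pow_of_le_one (by norm_num) (by norm_num) hdist)
      calc ν n (closedBall a r) ≤ ENNReal.ofReal (r ^ β) := hball n a r hr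
        _ ≤ ENNReal.ofReal (4 * r ^ β) * w (sInf T) n := by
            simp only [w, if_pos hle]
            rw [← ENNReal.ofReal_mul (by positivity)]
            refine ENNReal.ofReal_le_ofReal ?_
            nlinarith
        _ ≤ _ := by
            gcongr
            exact le_add_self
    · suffices h : ν n (closedBall a r) = 0 by simp [h]
      refine measure_mono_null (fun ζ hζ => ?_) (hsupp n)
      rintro ⟨h1, h2⟩
      refine hnT ?_
      rw [mem_closedBall, dist_eq_norm] at hζ
      simp only [hS, Set.mem_ofPred_eq, not_le] at hnS
      have h3 := norm_sub_norm_le ζ a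
      have h4 := norm_sub_norm_le a ζ
      rw [norm_sub_rev] at h4
      have h5 : (1 / 2 : ℝ) ^ (n + 1) = 2 * (1 / 2) ^ (n + 2) := by ring
      constructor <;> linarith
  calc ∑' n : ℕ, ν n (closedBall a r)
      ≤ ∑' n : ℕ, ENNReal.ofReal (4 * r ^ β) * (w (sInf S) n + w (sInf T) n) :=
        ENNReal.tsum_le_tsum hterm
    _ = ENNReal.ofReal (4 * r ^ β) * (2 + 2) := by
        rw [ENNReal.tsum_mul_left, ENNReal.tsum_add, tsum_ite_geometric_two,
          tsum_ite_geometric_two]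
    _ = ENNReal.ofReal (16 * r ^ β) := by
        have h4 : (2 + 2 : ℝ≥0∞) = ENNReal.ofReal 4 := by norm_num
        rw [h4, ← ENNReal.ofReal_mul (by positivity)]
        ring_nf

/-- For `0 < β < 1` there is a constant `K > 0`, depending only on `β`,
such that: whenever `(ν_n)_{n ≥ 1}` is a sequence of positive Borel measures on `ℂ`
(here indexed so that `ν n` is the paper's `ν_{n+1}`) with `supp ν_n` contained in the
annulus `{2^{-n-1} ≤ |z| ≤ 2^{-n}}` (expressed by the vanishing of `ν_n` on the
complement of the annulus), `ν_n(B̄(a,r)) ≤ r^β` for all `a, r > 0`, and total mass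
`ν_n(ℂ) ≤ 2^{-n}`, then for all `z ∈ ℂ` and `t > 0` the sum of the Poisson transforms
satisfies `∑_{n≥1} ∫ t/(π(t² + |z-ζ|²)^{3/2}) dν_n(ζ) ≤ K · t^{β-2}`. -/
theorem statement7 (β : ℝ) (hβ0 : 0 < β) (hβ1 : β < 1) :
    ∃ K : ℝ, 0 < K ∧
      ∀ ν : ℕ → Measure ℂ,
        (∀ n : ℕ, ν n {ζ : ℂ |
            ¬((2:ℝ) ^ (-(n:ℝ) - 2) ≤ ‖ζ‖ ∧ ‖ζ‖ ≤ (2:ℝ) ^ (-(n:ℝ) - 1))} = 0) →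
        (∀ (n : ℕ) (a : ℂ) (r : ℝ), 0 < r →
            ν n (Metric.closedBall a r) ≤ ENNReal.ofReal (r ^ β)) →
        (∀ n : ℕ, ν n Set.univ ≤ ENNReal.ofReal ((2:ℝ) ^ (-(n:ℝ) - 1))) →
        ∀ (z : ℂ) (t : ℝ), 0 < t →
          ∑' n : ℕ, ∫⁻ ζ, ENNReal.ofReal
              (t / (Real.pi * (t ^ 2 + ‖z - ζ‖ ^ 2) ^ ((3:ℝ) / 2))) ∂(ν n)
            ≤ ENNReal.ofReal (K * t ^ (β - 2)) := by
  have hpow : ∀ n k : ℕ, (2:ℝ) ^ (-(n:ℝ) - k) = (1 / 2) ^ (n + k) := by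
    intro n k
    rw [one_div, inv_pow, ← Real.rpow_natCast, ← Real.rpow_neg zero_le_two]
    push_cast
    ring_nf
  refine ⟨32 / 3 * 16, by norm_num, fun ν hsupp hball hmass z t ht => ?_⟩
  have hpow1 : ∀ n : ℕ, (2:ℝ) ^ (-(n:ℝ) - 1) = (1 / 2) ^ (n + 1) := fun n => mod_cast hpow n 1
  have hpow2 : ∀ n : ℕ, (2:ℝ) ^ (-(n:ℝ) - 2) = (1 / 2) ^ (n + 2) := fun n => mod_cast hpow n 2
  simp only [hpow1, hpow2] at hsupp hmass
  rw [← lintegral_sum_measure]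
  refine lintegral_poisson_le hβ1.le (by norm_num) (fun r hr => ?_) ht
  rw [Measure.sum_apply _ measurableSet_closedBall]
  exact tsum_measure_closedBall_le hβ0.le hβ1.le hsupp hball hmass z hr

end
end

section
/- Let 0 < α < 1 and C > 0, and let f : ℂ → ℂ satisfy |f(x) − f(y)| ≤ C|x−y|^α for all x, y ∈ ℂ. Let z, z', w ∈ ℂ satisfy z ≠ w, z' ≠ w, |z − w| ≤ 1, and |z − z'| ≤ |z − w|/2. Then |(f(z) − f(w))/|z−w|^α − (f(z') − f(w))/|z'−w|^α| ≤ 4C · |z − z'|^α / |z − w|. -/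
open Complex

theorem Real.abs_rpow_sub_rpow_le {p a b : ℝ} (ha : 0 ≤ a) (hb : 0 ≤ b) (hp : 0 ≤ p)
    (hp1 : p ≤ 1) : |a ^ p - b ^ p| ≤ |a - b| ^ p := by
  have key : ∀ x y : ℝ, 0 ≤ y → 0 ≤ x → x ^ p ≤ |x - y| ^ p + y ^ p := fun x y hy hx =>
    calc x ^ p ≤ (|x - y| + y) ^ p :=
          Real.rpow_le_rpow hx (by linarith [le_abs_self (x - y)]) hp
      _ ≤ |x - y| ^ p + y ^ p := by
          exact_mod_cast NNReal.rpow_add_le_add_rpow ⟨|x - y|, abs_nonneg _⟩ ⟨y, hy⟩ hp hp1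
  have h₁ := key a b hb ha
  have h₂ := key b a ha hb
  rw [abs_sub_comm b a] at h₂
  rw [abs_le]
  constructor <;> linarith

/-- A local Hölder-continuity estimate for the difference-quotient
functionals `Q(z,w)(f) = (f(z) - f(w))/|z-w|^α` in the dual Lipschitz norm:  if `f` is
`C`-Hölder of order `α` on `ℂ`, `z ≠ w`, `z' ≠ w`, `|z - w| ≤ 1` and
`|z - z'| ≤ |z - w|/2`, then
`|Q(z,w)(f) - Q(z',w)(f)| ≤ 4C|z - z'|^α/|z - w|`. -/
theorem statement10 (α C : ℝ) (hα0 : 0 < α) (hα1 : α < 1) (hC : 0 < C)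
    (f : ℂ → ℂ) (hf : ∀ x y : ℂ, ‖f x - f y‖ ≤ C * ‖x - y‖ ^ α)
    (z z' w : ℂ) (hzw : z ≠ w) (hz'w : z' ≠ w)
    (h1 : ‖z - w‖ ≤ 1) (h2 : ‖z - z'‖ ≤ ‖z - w‖ / 2) :
    ‖(f z - f w) / ((‖z - w‖ ^ α : ℝ) : ℂ) - (f z' - f w) / ((‖z' - w‖ ^ α : ℝ) : ℂ)‖ ≤
      4 * C * ‖z - z'‖ ^ α / ‖z - w‖ := by
  have hd : 0 < ‖z - w‖ := norm_pos_iff.mpr (sub_ne_zero.mpr hzw)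
  have hd' : 0 < ‖z' - w‖ := norm_pos_iff.mpr (sub_ne_zero.mpr hz'w)
  have hD : 0 < ‖z - w‖ ^ α := Real.rpow_pos_of_pos hd α
  have hD' : 0 < ‖z' - w‖ ^ α := Real.rpow_pos_of_pos hd' α
  have hE : 0 ≤ ‖z - z'‖ ^ α := by positivity
  have hdD : ‖z - w‖ ≤ ‖z - w‖ ^ α := by
    simpa using Real.rpow_le_rpow_of_exponent_ge hd h1 hα1.le
  have hdiff : |‖z' - w‖ ^ α - ‖z - w‖ ^ α| ≤ ‖z - z'‖ ^ α := by
    refine (Real.abs_rpow_sub_rpow_le hd'.le hd.le hα0.le hα1.le).trans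
      (Real.rpow_le_rpow (abs_nonneg _) ?_ hα0.le)
    simpa [norm_sub_rev z z'] using abs_norm_sub_norm_le (z' - w) (z - w)
  have hzz' := hf z z'
  have hz'w_le := hf z' w
  generalize ‖z - w‖ ^ α = D at *
  generalize ‖z' - w‖ ^ α = D' at *
  generalize ‖z - z'‖ ^ α = E at *
  have hDc : (D : ℂ) ≠ 0 := by exact_mod_cast hD.ne'
  have hDc' : (D' : ℂ) ≠ 0 := by exact_mod_cast hD'.ne'
  have hsplit : (f z - f w) / (D : ℂ) - (f z' - f w) / (D' : ℂ) =
      (f z - f z') / (D : ℂ) + (f z' - f w) / (D' : ℂ) * (((D' - D : ℝ) : ℂ) / (D : ℂ)) := by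
    push_cast
    field_simp
    ring
  have hquot : ‖f z' - f w‖ / D' ≤ C := (div_le_iff₀ hD').mpr hz'w_le
  calc ‖(f z - f w) / (D : ℂ) - (f z' - f w) / (D' : ℂ)‖
      ≤ ‖f z - f z'‖ / D + ‖f z' - f w‖ / D' * (|D' - D| / D) := by
        rw [hsplit]
        refine (norm_add_le _ _).trans_eq ?_
        simp only [norm_mul, norm_div, Complex.norm_real, Real.norm_eq_abs, abs_of_pos hD,
          abs_of_pos hD']
    _ ≤ C * E / D + C * (E / D) := by gcongr
    _ = 2 * C * E / D := by ring
    _ ≤ 4 * C * E / ‖z - w‖ := by gcongr; norm_num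
end

section
/- Let k ∈ ℕ and let φ, ψ : ℝ^d → ℂ be smooth compactly supported functions. Then N_k(φ·ψ) ≤ 2^k · N_k(φ) · N_k(ψ). -/
open Metric

noncomputable section

/-- A differentiable function supported in a bounded set `K` is bounded by `diam K` times any bound
on its derivative. -/
theorem norm_le_diam_mul_of_norm_fderiv_le {E F : Type*} [NormedAddCommGroup E] [NormedSpace ℝ E]
    [Nontrivial E] [NormedAddCommGroup F] [NormedSpace ℝ F] {f : E → F} {K : Set E} {C : ℝ}
    (hf : Differentiable ℝ f) (hK : Bornology.IsBounded K) (hfK : Function.support f ⊆ K)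
    (hC : ∀ x, ‖fderiv ℝ f x‖ ≤ C) (x : E) : ‖f x‖ ≤ Metric.diam K * C := by
  have hC0 : 0 ≤ C := (norm_nonneg _).trans (hC x)
  by_cases hx : f x = 0
  · rw [hx, norm_zero]
    exact mul_nonneg Metric.diam_nonneg hC0
  have hlt : ∀ t, Metric.diam K < t → ‖f x‖ ≤ t * C := by
    intro t ht
    have ht0 : 0 ≤ t := Metric.diam_nonneg.trans ht.le
    obtain ⟨v, hv⟩ := exists_norm_eq E ht0
    have hy : f (x + v) = 0 := by
      by_contra hy
      have := Metric.dist_le_diam_of_mem hK (hfK hy) (hfK hx)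
      rw [dist_eq_norm, add_sub_cancel_left, hv] at this
      exact this.not_gt ht
    have := convex_univ.norm_image_sub_le_of_norm_fderiv_le (𝕜 := ℝ) (fun z _ => hf z)
      (fun z _ => hC z) (Set.mem_univ (x + v)) (Set.mem_univ x)
    rw [hy, sub_zero, sub_add_cancel_left, norm_neg, hv] at this
    linarith
  have hlim : Filter.Tendsto (fun t => t * C) (nhdsWithin (Metric.diam K) (Set.Ioi (Metric.diam K)))
      (nhds (Metric.diam K * C)) :=
    (Filter.tendsto_id.mul_const C).mono_left nhdsWithin_le_nhds
  exact ge_of_tendsto hlim (Filter.eventually_of_mem self_mem_nhdsWithin hlt)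

/-- The iterated derivatives of a smooth compactly supported function are bounded. -/
theorem norm_iteratedFDeriv_le_iSup {E F : Type*} [NormedAddCommGroup E] [NormedSpace ℝ E]
    [NormedAddCommGroup F] [NormedSpace ℝ F] {f : E → F}
    (hf : ContDiff ℝ (⊤ : ℕ∞) f) (hfs : HasCompactSupport f) (k : ℕ) (x : E) :
    ‖iteratedFDeriv ℝ k f x‖ ≤ ⨆ y, ‖iteratedFDeriv ℝ k f y‖ := by
  refine le_ciSup (f := fun y => ‖iteratedFDeriv ℝ k f y‖) ?_ x
  have hcont : Continuous (iteratedFDeriv ℝ k f) :=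
    hf.continuous_iteratedFDeriv (by exact_mod_cast le_top)
  exact hcont.norm.bddAbove_range_of_hasCompactSupport (hfs.iteratedFDeriv k).norm

/-- Lower-order derivatives are controlled by higher-order ones through the diameter of the
support. -/
theorem norm_iteratedFDeriv_le_diam_pow_mul {E F : Type*} [NormedAddCommGroup E]
    [NormedSpace ℝ E] [Nontrivial E] [NormedAddCommGroup F] [NormedSpace ℝ F] {f : E → F}
    (hf : ContDiff ℝ (⊤ : ℕ∞) f) (hfs : HasCompactSupport f) (i j : ℕ) (x : E) :
    ‖iteratedFDeriv ℝ i f x‖ ≤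
      Metric.diam (tsupport f) ^ j * ⨆ y, ‖iteratedFDeriv ℝ (i + j) f y‖ := by
  induction j generalizing i x with
  | zero => simpa using norm_iteratedFDeriv_le_iSup hf hfs i x
  | succ j ih =>
    rw [pow_succ', mul_assoc]
    refine norm_le_diam_mul_of_norm_fderiv_le
      (hf.differentiable_iteratedFDeriv (by exact_mod_cast WithTop.coe_lt_top i))
      hfs.isCompact.isBounded (support_iteratedFDeriv_subset i) (fun y => ?_) x
    rw [norm_fderiv_iteratedFDeriv, ← add_assoc, add_right_comm]
    exact ih (i + 1) y

/-- For smooth compactly supported `φ, ψ : ℝ^d → ℂ`,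
`N_k(φ·ψ) ≤ 2^k · N_k(φ) · N_k(ψ)`. -/
theorem statement11 (d k : ℕ) (φ ψ : EuclideanSpace ℝ (Fin d) → ℂ)
    (hφ : ContDiff ℝ (⊤ : ℕ∞) φ) (hφs : HasCompactSupport φ)
    (hψ : ContDiff ℝ (⊤ : ℕ∞) ψ) (hψs : HasCompactSupport ψ) :
    Nk k (fun x => φ x * ψ x) ≤ 2 ^ k * Nk k φ * Nk k ψ := by
  have hA : 0 ≤ ⨆ y, ‖iteratedFDeriv ℝ k φ y‖ := Real.iSup_nonneg fun _ => norm_nonneg _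
  have hB : 0 ≤ ⨆ y, ‖iteratedFDeriv ℝ k ψ y‖ := Real.iSup_nonneg fun _ => norm_nonneg _
  have hDφ : Metric.diam (tsupport fun x => φ x * ψ x) ≤ Metric.diam (tsupport φ) :=
    Metric.diam_mono (tsupport_mul_subset_left (f := φ) (g := ψ)) hφs.isCompact.isBounded
  have hDψ : Metric.diam (tsupport fun x => φ x * ψ x) ≤ Metric.diam (tsupport ψ) :=
    Metric.diam_mono (tsupport_mul_subset_right (f := φ) (g := ψ)) hψs.isCompact.isBounded
  have hleib := fun x => norm_iteratedFDeriv_mul_le (𝕜 := ℝ) hφ hψ x (n := k)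
    (by exact_mod_cast le_top)
  unfold Nk
  set D := Metric.diam (tsupport fun x => φ x * ψ x)
  set a := Metric.diam (tsupport φ)
  set b := Metric.diam (tsupport ψ)
  set A := ⨆ y, ‖iteratedFDeriv ℝ k φ y‖
  set B := ⨆ y, ‖iteratedFDeriv ℝ k ψ y‖ with hB_def
  have hD : 0 ≤ D := Metric.diam_nonneg
  have ha : 0 ≤ a := Metric.diam_nonneg
  have hb : 0 ≤ b := Metric.diam_nonneg
  have hR : 0 ≤ 2 ^ k * (a ^ k * A) * (b ^ k * B) := by positivity
  rw [Real.mul_iSup_of_nonneg (pow_nonneg hD k)]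
  refine Real.iSup_le (fun x => ?_) hR
  have hterm : ∀ i ∈ Finset.range (k + 1),
      D ^ k * (‖iteratedFDeriv ℝ i φ x‖ * ‖iteratedFDeriv ℝ (k - i) ψ x‖) ≤
        (a ^ k * A) * (b ^ k * B) := by
    intro i hi
    obtain ⟨j, rfl⟩ := Nat.exists_eq_add_of_le (Finset.mem_range_succ_iff.mp hi)
    rw [Nat.add_sub_cancel_left]
    rcases subsingleton_or_nontrivial (EuclideanSpace ℝ (Fin d)) with hE | hE
    · rcases Nat.eq_zero_or_pos (i + j) with h0 | hpos
      · obtain ⟨rfl, rfl⟩ := Nat.add_eq_zero_iff.mp h0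
        simp only [Nat.add_zero, pow_zero, one_mul]
        exact mul_le_mul (norm_iteratedFDeriv_le_iSup hφ hφs _ x)
          (norm_iteratedFDeriv_le_iSup hψ hψs _ x) (norm_nonneg _) hA
      · have hD0 : D = 0 := Metric.diam_subsingleton Set.subsingleton_of_subsingleton
        rw [hD0, zero_pow hpos.ne', zero_mul]
        positivity
    · have h1 : ‖iteratedFDeriv ℝ i φ x‖ ≤ a ^ j * A :=
        norm_iteratedFDeriv_le_diam_pow_mul hφ hφs i j x
      have h2 : ‖iteratedFDeriv ℝ j ψ x‖ ≤ b ^ i * B := by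
        rw [hB_def, add_comm i j]
        exact norm_iteratedFDeriv_le_diam_pow_mul hψ hψs j i x
      calc D ^ (i + j) * (‖iteratedFDeriv ℝ i φ x‖ * ‖iteratedFDeriv ℝ j ψ x‖)
          = D ^ i * D ^ j * (‖iteratedFDeriv ℝ i φ x‖ * ‖iteratedFDeriv ℝ j ψ x‖) := by
            rw [pow_add]
        _ ≤ a ^ i * b ^ j * ((a ^ j * A) * (b ^ i * B)) := by gcongr
        _ = (a ^ (i + j) * A) * (b ^ (i + j) * B) := by ring
  calc D ^ k * ‖iteratedFDeriv ℝ k (fun x => φ x * ψ x) x‖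
      ≤ D ^ k * ∑ i ∈ Finset.range (k + 1), (k.choose i : ℝ) * ‖iteratedFDeriv ℝ i φ x‖ *
          ‖iteratedFDeriv ℝ (k - i) ψ x‖ := by
        gcongr
        exact hleib x
    _ = ∑ i ∈ Finset.range (k + 1), (k.choose i : ℝ) *
          (D ^ k * (‖iteratedFDeriv ℝ i φ x‖ * ‖iteratedFDeriv ℝ (k - i) ψ x‖)) := by
        rw [Finset.mul_sum]
        exact Finset.sum_congr rfl fun i _ => by ring
    _ ≤ ∑ i ∈ Finset.range (k + 1), (k.choose i : ℝ) * ((a ^ k * A) * (b ^ k * B)) :=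
        Finset.sum_le_sum fun i hi => mul_le_mul_of_nonneg_left (hterm i hi) (Nat.cast_nonneg _)
    _ = 2 ^ k * (a ^ k * A) * (b ^ k * B) := by
        rw [← Finset.sum_mul, ← Nat.cast_sum, Nat.sum_range_choose]
        push_cast
        ring

end
end

section
/- For every a ∈ ℂ and every r > 0, the integral of the function z ↦ 1/(π|z|) over the closed disc B̄(a, r), with respect to two-dimensional Lebesgue (area) measure, is at most 2r: ∫_{B̄(a,r)} 1/(π|z|) dA(z) ≤ 2r. -/
open MeasureTheory Metric

/-- Among the sets with the same finite measure as `t`, the integral of a function that is at least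
`c` on `t` and at most `c` off `t` is largest on `t`. -/
theorem setLIntegral_le_setLIntegral_of_measure_eq {α : Type*} [MeasurableSpace α] {μ : Measure α}
    {f : α → ENNReal} {c : ENNReal} {s t : Set α} (hs : MeasurableSet s) (ht : MeasurableSet t)
    (hst : μ s = μ t) (hfin : μ t ≠ ⊤) (hin : ∀ᵐ x ∂μ, x ∈ t → c ≤ f x)
    (hout : ∀ x ∉ t, f x ≤ c) :
    ∫⁻ x in s, f x ∂μ ≤ ∫⁻ x in t, f x ∂μ := by
  have hdiff : μ (s \ t) = μ (t \ s) := by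
    have h₁ := measure_inter_add_sdiff (μ := μ) s ht
    have h₂ := measure_inter_add_sdiff (μ := μ) t hs
    rw [Set.inter_comm t s, ← hst, ← h₁] at h₂
    exact ((ENNReal.add_right_inj (measure_ne_top_of_subset Set.inter_subset_right hfin)).1
      h₂).symm
  calc ∫⁻ x in s, f x ∂μ = ∫⁻ x in s ∩ t, f x ∂μ + ∫⁻ x in s \ t, f x ∂μ :=
        (lintegral_inter_add_sdiff f s ht).symm
    _ ≤ ∫⁻ x in s ∩ t, f x ∂μ + ∫⁻ _ in s \ t, c ∂μ := by
        refine add_le_add le_rfl ?_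
        exact setLIntegral_mono measurable_const fun x hx => hout x hx.2
    _ = ∫⁻ x in t ∩ s, f x ∂μ + ∫⁻ _ in t \ s, c ∂μ := by
        rw [setLIntegral_const, setLIntegral_const, hdiff, Set.inter_comm]
    _ ≤ ∫⁻ x in t ∩ s, f x ∂μ + ∫⁻ x in t \ s, f x ∂μ := by
        refine add_le_add le_rfl ?_
        refine setLIntegral_mono_ae' (ht.diff hs) ?_
        filter_upwards [hin] with x hx hxt using hx hxt.1
    _ = ∫⁻ x in t, f x ∂μ := lintegral_inter_add_sdiff f t hs

theorem Complex.lintegral_closedBall_zero_one_div_pi_mul_norm {r : ℝ} (hr : 0 ≤ r) :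
    ∫⁻ z in closedBall (0 : ℂ) r, ENNReal.ofReal (1 / (Real.pi * ‖z‖)) = ENNReal.ofReal (2 * r) := by
  rw [← lintegral_indicator measurableSet_closedBall, ← Complex.lintegral_comp_polarCoord_symm]
  have hmeas : MeasurableSet (Set.Ioc 0 r ×ˢ Set.Ioo (-Real.pi) Real.pi) :=
    measurableSet_Ioc.prod measurableSet_Ioo
  have hsub : Set.Ioc 0 r ×ˢ Set.Ioo (-Real.pi) Real.pi ⊆ polarCoord.target :=
    Set.prod_mono Set.Ioc_subset_Ioi_self subset_rfl
  calc _ = ∫⁻ p in polarCoord.target, (Set.Ioc 0 r ×ˢ Set.Ioo (-Real.pi) Real.pi).indicator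
            (fun _ => ENNReal.ofReal (1 / Real.pi)) p := by
        refine setLIntegral_congr_fun polarCoord.open_target.measurableSet fun p hp => ?_
        obtain ⟨hp₁, hp₂⟩ : 0 < p.1 ∧ p.2 ∈ Set.Ioo (-Real.pi) Real.pi := hp
        by_cases h : p.1 ≤ r
        · have hball : Complex.polarCoord.symm p ∈ closedBall (0 : ℂ) r := by
            rwa [mem_closedBall_zero_iff, Complex.norm_polarCoord_symm, abs_of_pos hp₁]
          have hrect : p ∈ Set.Ioc 0 r ×ˢ Set.Ioo (-Real.pi) Real.pi := ⟨⟨hp₁, h⟩, hp₂⟩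
          rw [Set.indicator_of_mem hball, Set.indicator_of_mem hrect,
            Complex.norm_polarCoord_symm, abs_of_pos hp₁, smul_eq_mul,
            ← ENNReal.ofReal_mul hp₁.le]
          congr 1
          field_simp
        · have hball : Complex.polarCoord.symm p ∉ closedBall (0 : ℂ) r := by
            rwa [mem_closedBall_zero_iff, Complex.norm_polarCoord_symm, abs_of_pos hp₁]
          rw [Set.indicator_of_notMem hball, Set.indicator_of_notMem fun hmem => h hmem.1.2,
            smul_zero]
    _ = ENNReal.ofReal (2 * r) := by
        rw [lintegral_indicator hmeas, Measure.restrict_restrict hmeas,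
          Set.inter_eq_left.2 hsub, setLIntegral_const, Measure.volume_eq_prod,
          Measure.prod_prod, Real.volume_Ioc, Real.volume_Ioo,
          ← ENNReal.ofReal_mul (by linarith), ← ENNReal.ofReal_mul (by positivity)]
        congr 1
        field_simp
        ring

/-- For every `a ∈ ℂ` and `r > 0`, the integral of `z ↦ 1/(π|z|)`
over the closed disc `B̄(a, r)` with respect to Lebesgue area measure is at most `2r`. -/
theorem statement13 (a : ℂ) (r : ℝ) (hr : 0 < r) :
    ∫⁻ z in Metric.closedBall a r, ENNReal.ofReal (1 / (Real.pi * ‖z‖)) ∂volume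
      ≤ ENNReal.ofReal (2 * r) := by
  rw [← Complex.lintegral_closedBall_zero_one_div_pi_mul_norm hr.le]
  refine setLIntegral_le_setLIntegral_of_measure_eq (c := ENNReal.ofReal (1 / (Real.pi * r)))
    measurableSet_closedBall measurableSet_closedBall ?_ measure_closedBall_lt_top.ne ?_ ?_
  · rw [Complex.volume_closedBall, Complex.volume_closedBall]
  · filter_upwards [Measure.ae_ne volume (0 : ℂ)] with z hz hzr
    rw [mem_closedBall_zero_iff] at hzr
    have := norm_pos_iff.2 hz
    gcongr
  · intro z hz
    rw [mem_closedBall_zero_iff, not_le] at hz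
    gcongr
end
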